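/- arXiv:1504.02043 — 6 statements merged into one kernel-verified Lean document; each statement's English description precedes it below -/
import Mathlib

section
/- Fix integers 1 ≤ k ≤ n. There exists a constant c = c(n, k) > 0 such that the following holds for every δ > 0. Let V and W be k-dimensional affine subspaces of ℝⁿ with V ∩ B_{1/2}(0) ≠ ∅. If V ∩ B_1(0) ⊆ B_δ(W ∩ B_1(0)), then W ∩ B_1(0) ⊆ B_{cδ}(V ∩ B_1(0)); in particular d_H(V ∩ B_1(0), W ∩ B_1(0)) ≤ c δ. -/
open MeasureTheory Metric Set

noncomputable section

/-- Euclidean `n`-space. -/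
abbrev En (n : ℕ) : Type := EuclideanSpace ℝ (Fin n)

/-- A `k`-dimensional affine subspace of `ℝⁿ`: nonempty, with direction of finrank `k`. -/
def IsAffineSubspaceDim (n k : ℕ) (L : AffineSubspace ℝ (En n)) : Prop :=
  (L : Set (En n)).Nonempty ∧ Module.finrank ℝ L.direction = k

theorem aux_lin {n : ℕ} (V W : Submodule ℝ (En n)) (h : Module.finrank ℝ V = Module.finrank ℝ W)
    (ε : ℝ) (hε : ε ≤ 1 / 2)
    (H : ∀ v ∈ V, ∃ w ∈ W, ‖v - w‖ ≤ ε * ‖v‖) :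
    ∀ w ∈ W, ∃ v ∈ V, ‖v - w‖ ≤ 2 * ε * ‖w‖ := by
  have key : ∀ v ∈ V, ‖v - W.starProjection v‖ ≤ ε * ‖v‖ := by
    intro v hv
    obtain ⟨w, hw, hvw⟩ := H v hv
    rw [Submodule.starProjection_minimal]
    refine le_trans (ciInf_le ⟨0, ?_⟩ (⟨w, hw⟩ : W)) hvw
    rintro _ ⟨x, rfl⟩
    exact norm_nonneg _
  have key2 : ∀ v ∈ V, ‖v‖ ≤ 2 * ‖W.starProjection v‖ := by
    intro v hv
    have h1 := key v hv
    have h2 : ‖v‖ ≤ ‖v - W.starProjection v‖ + ‖W.starProjection v‖ := by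
      simpa using norm_add_le (v - W.starProjection v) (W.starProjection v)
    have h3 : ε * ‖v‖ ≤ 1 / 2 * ‖v‖ := mul_le_mul_of_nonneg_right hε (norm_nonneg _)
    linarith
  let f : V →ₗ[ℝ] W := (W.orthogonalProjection : En n →ₗ[ℝ] W) ∘ₗ V.subtype
  have hf : ∀ v : V, ((f v : W) : En n) = W.starProjection (v : En n) := fun v => rfl
  have hinj : Function.Injective f := by
    rw [← LinearMap.ker_eq_bot, LinearMap.ker_eq_bot']
    intro v hv
    have h1 := key2 v v.2
    rw [← hf, hv] at h1
    have : ‖(v : En n)‖ ≤ 0 := by simpa using h1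
    exact Subtype.ext (norm_le_zero_iff.mp this)
  have hsurj := (LinearMap.injective_iff_surjective_of_finrank_eq_finrank h).mp hinj
  intro w hw
  obtain ⟨v, hv⟩ := hsurj ⟨w, hw⟩
  have hw' : W.starProjection (v : En n) = w := by rw [← hf, hv]
  have h1 := key v v.2
  have h2 := key2 v v.2
  rw [hw'] at h1 h2
  refine ⟨v, v.2, ?_⟩
  rcases le_or_gt 0 ε with h0 | h0
  · nlinarith
  · have := norm_nonneg ((v : En n) - w)
    have h4 : ‖(v : En n)‖ = 0 := by
      have := norm_nonneg (v : En n)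
      nlinarith
    have h5 : (v : En n) = 0 := norm_eq_zero.mp h4
    have h6 : w = 0 := by rw [← hw', h5]; simp
    rw [h5, h6]; simp

/-- Lemma 4.3: one-sided closeness of affine subspaces of equal
dimension implies two-sided closeness. -/
theorem statement5 (n k : ℕ) (hk : 1 ≤ k) (hkn : k ≤ n) :
    ∃ c : ℝ, 0 < c ∧
      ∀ δ : ℝ, 0 < δ →
      ∀ V W : AffineSubspace ℝ (En n),
        IsAffineSubspaceDim n k V → IsAffineSubspaceDim n k W →
        ((V : Set (En n)) ∩ ball (0 : En n) (1 / 2)).Nonempty →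
        (V : Set (En n)) ∩ ball (0 : En n) 1 ⊆
          thickening δ ((W : Set (En n)) ∩ ball (0 : En n) 1) →
        ((W : Set (En n)) ∩ ball (0 : En n) 1 ⊆
            thickening (c * δ) ((V : Set (En n)) ∩ ball (0 : En n) 1)) ∧
        hausdorffDist ((V : Set (En n)) ∩ ball (0 : En n) 1)
            ((W : Set (En n)) ∩ ball (0 : En n) 1) ≤ c * δ := by
  refine ⟨165, by norm_num, ?_⟩
  intro δ hδ V W hV hW hne hsub
  suffices hmain : (W : Set (En n)) ∩ ball (0 : En n) 1 ⊆
            thickening (165 * δ) ((V : Set (En n)) ∩ ball (0 : En n) 1) by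
    refine ⟨hmain, hausdorffDist_le_of_mem_dist (by positivity) ?_ ?_⟩
    · intro x hx
      obtain ⟨y, hy, hxy⟩ := mem_thickening_iff.mp (hsub hx)
      exact ⟨y, hy, by linarith⟩
    · intro x hx
      obtain ⟨y, hy, hxy⟩ := mem_thickening_iff.mp (hmain hx)
      exact ⟨y, hy, hxy.le⟩
  obtain ⟨p, hpV, hp⟩ := hne
  rw [mem_ball_zero_iff] at hp
  have hp1 : p ∈ (V : Set (En n)) ∩ ball (0 : En n) 1 :=
    ⟨hpV, by rw [mem_ball_zero_iff]; linarith⟩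
  rintro y ⟨hyW, hy⟩
  rw [mem_ball_zero_iff] at hy
  rw [mem_thickening_iff]
  rcases le_or_gt (1 / 66) δ with hbig | hsmall
  · refine ⟨p, hp1, ?_⟩
    rw [dist_eq_norm]
    have := norm_sub_le y p
    linarith
  obtain ⟨q, ⟨hqW, hq⟩, hpq⟩ := mem_thickening_iff.mp (hsub hp1)
  rw [mem_ball_zero_iff] at hq
  rw [dist_eq_norm] at hpq
  have hlin := aux_lin V.direction W.direction (hV.2.trans hW.2.symm) (8 * δ) (by linarith) (by
    intro v hv
    rcases eq_or_ne v 0 with rfl | hv0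
    · exact ⟨0, W.direction.zero_mem, by simp⟩
    have hvn : 0 < ‖v‖ := norm_pos_iff.mpr hv0
    set s : ℝ := 1 / (4 * ‖v‖) with hs
    have hs0 : 0 < s := by positivity
    have hsv : s * ‖v‖ = 1 / 4 := by rw [hs]; field_simp
    have hm : s • v + p ∈ (V : Set (En n)) ∩ ball (0 : En n) 1 := by
      refine ⟨AffineSubspace.vadd_mem_of_mem_direction (V.direction.smul_mem s hv) hpV, ?_⟩
      rw [mem_ball_zero_iff]
      have := norm_add_le (s • v) p
      rw [norm_smul, Real.norm_of_nonneg hs0.le, hsv] at this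
      linarith
    obtain ⟨r, ⟨hrW, -⟩, hr⟩ := mem_thickening_iff.mp (hsub hm)
    rw [dist_eq_norm] at hr
    have hd : r - q ∈ W.direction := AffineSubspace.vsub_mem_direction hrW hqW
    refine ⟨s⁻¹ • (r - q), W.direction.smul_mem _ hd, ?_⟩
    have e : v - s⁻¹ • (r - q) = s⁻¹ • ((s • v + p - r) - (p - q)) := by
      have : v = s⁻¹ • (s • v) := by rw [inv_smul_smul₀ hs0.ne']
      rw [this, ← smul_sub, ← this]
      congr 1
      abel
    have h2 := norm_sub_le (s • v + p - r) (p - q)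
    rw [e, norm_smul, norm_inv, Real.norm_of_nonneg hs0.le]
    have hsi : s⁻¹ = 4 * ‖v‖ := by rw [hs]; simp
    rw [hsi]
    nlinarith)
  obtain ⟨v, hv, hvy⟩ := hlin (y - q) (AffineSubspace.vsub_mem_direction hyW hqW)
  have hyq : ‖y - q‖ ≤ 2 := by
    have := norm_sub_le y q
    linarith
  have hvy' : ‖v - (y - q)‖ ≤ 32 * δ := by nlinarith
  have hx : ‖(v + p) - y‖ < 33 * δ := by
    have e : (v + p) - y = (v - (y - q)) + (p - q) := by abel
    rw [e]
    have := norm_add_le (v - (y - q)) (p - q)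
    linarith
  have hxn : ‖v + p‖ < 1 + 33 * δ := by
    have := norm_add_le ((v + p) - y) y
    rw [sub_add_cancel] at this
    linarith
  have hvn : ‖v‖ < 2 := by
    have := norm_sub_le (v + p) p
    rw [add_sub_cancel_right] at this
    linarith
  refine ⟨(1 - 66 * δ) • v + p, ⟨AffineSubspace.vadd_mem_of_mem_direction
    (V.direction.smul_mem _ hv) hpV, ?_⟩, ?_⟩
  · rw [mem_ball_zero_iff]
    have e : (1 - 66 * δ) • v + p = (1 - 66 * δ) • (v + p) + (66 * δ) • p := by module
    have := norm_add_le ((1 - 66 * δ) • (v + p)) ((66 * δ) • p)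
    rw [← e, norm_smul, norm_smul, Real.norm_of_nonneg (by linarith),
      Real.norm_of_nonneg (by linarith)] at this
    nlinarith
  · rw [dist_comm, dist_eq_norm]
    have e : (1 - 66 * δ) • v + p - y = ((v + p) - y) - (66 * δ) • v := by module
    rw [e]
    have := norm_sub_le ((v + p) - y) ((66 * δ) • v)
    rw [norm_smul, Real.norm_of_nonneg (by linarith)] at this
    nlinarith
end
end

section
/- Let H be a real Hilbert space and let V, W be closed linear subspaces of H, with orthogonal complements V^⊥, W^⊥. Then d_G(V^⊥, W^⊥) = d_G(V, W), where d_G(V, W) := d_H(V ∩ B̄_1(0), W ∩ B̄_1(0)) is the Hausdorff distance between the intersections of the subspaces with the closed unit ball. -/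
open MeasureTheory Metric Set

noncomputable section

lemma gr_aux {H : Type*} [NormedAddCommGroup H] [InnerProductSpace ℝ H]
    (V W : Submodule ℝ H) [W.HasOrthogonalProjection] (r : ℝ) (hr : 0 ≤ r)
    (h : ∀ u ∈ (W : Set H) ∩ closedBall (0 : H) 1, ∃ v ∈ (V : Set H) ∩ closedBall (0 : H) 1,
      dist u v ≤ r) (x : H) (hx : x ∈ (Vᗮ : Set H) ∩ closedBall (0 : H) 1) :
    ∃ y ∈ (Wᗮ : Set H) ∩ closedBall (0 : H) 1, dist x y ≤ r := by
  obtain ⟨hxV, hx1⟩ := hx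
  rw [mem_closedBall_zero_iff] at hx1
  have hyo := W.sub_starProjection_mem_orthogonal x
  have hwm := W.starProjection_apply_mem x
  set w := W.starProjection x with hw
  have hxy : inner ℝ w (x - w) = 0 := (Submodule.mem_orthogonal W _).1 hyo w hwm
  have hwx : inner ℝ w x = ‖w‖ * ‖w‖ := by
    rw [inner_sub_right, real_inner_self_eq_norm_mul_norm] at hxy
    linarith
  refine ⟨x - w, ⟨hyo, ?_⟩, ?_⟩
  · rw [mem_closedBall_zero_iff]
    have h2 := norm_add_sq_eq_norm_sq_add_norm_sq_of_inner_eq_zero w (x - w) hxy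
    rw [add_sub_cancel] at h2
    nlinarith [norm_nonneg (x - w), norm_nonneg w, norm_nonneg x]
  · rw [dist_eq_norm, sub_sub_cancel]
    rcases (norm_nonneg w).eq_or_lt with h0 | h0
    · rwa [← h0]
    · obtain ⟨v, ⟨hv, -⟩, hd⟩ := h (‖w‖⁻¹ • w) ⟨W.smul_mem _ hwm, by
        rw [mem_closedBall_zero_iff, norm_smul, norm_inv, norm_norm, inv_mul_cancel₀ h0.ne']⟩
      rw [dist_eq_norm] at hd
      have hvx : inner ℝ v x = 0 := (Submodule.mem_orthogonal V _).1 hxV v hv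
      have h3 : inner ℝ (‖w‖⁻¹ • w - v) x = ‖w‖ := by
        rw [inner_sub_left, hvx, real_inner_smul_left, hwx, inv_mul_cancel_left₀ h0.ne', sub_zero]
      have h4 := real_inner_le_norm (‖w‖⁻¹ • w - v) x
      rw [h3] at h4
      calc ‖w‖ ≤ _ := h4
        _ ≤ r * 1 := mul_le_mul hd hx1 (norm_nonneg _) hr
        _ = r := mul_one r

lemma gr_le {H : Type*} [NormedAddCommGroup H] [InnerProductSpace ℝ H]
    (V W : Submodule ℝ H) [V.HasOrthogonalProjection] [W.HasOrthogonalProjection] :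
    hausdorffDist ((Vᗮ : Set H) ∩ closedBall (0 : H) 1) ((Wᗮ : Set H) ∩ closedBall (0 : H) 1)
      ≤ hausdorffDist ((V : Set H) ∩ closedBall (0 : H) 1)
          ((W : Set H) ∩ closedBall (0 : H) 1) := by
  have fin : hausdorffEDist ((V : Set H) ∩ closedBall (0 : H) 1)
      ((W : Set H) ∩ closedBall (0 : H) 1) ≠ ⊤ :=
    hausdorffEDist_ne_top_of_nonempty_of_bounded ⟨0, V.zero_mem, by simp⟩ ⟨0, W.zero_mem, by simp⟩
      (isBounded_closedBall.subset inter_subset_right)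
      (isBounded_closedBall.subset inter_subset_right)
  refine le_of_forall_gt_imp_ge_of_dense fun r hr => ?_
  have hr0 : 0 ≤ r := hausdorffDist_nonneg.trans hr.le
  refine hausdorffDist_le_of_mem_dist hr0 (gr_aux V W r hr0 fun u hu => ?_)
    (gr_aux W V r hr0 fun u hu => ?_)
  · obtain ⟨v, hv, hd⟩ := exists_dist_lt_of_hausdorffDist_lt' hu hr fin
    exact ⟨v, hv, by rw [dist_comm]; exact hd.le⟩
  · obtain ⟨v, hv, hd⟩ := exists_dist_lt_of_hausdorffDist_lt hu hr fin
    exact ⟨v, hv, hd.le⟩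

/-- Grassmannian distance of orthogonal complements: in a real Hilbert
space, `d_G(V⊥, W⊥) = d_G(V, W)`, where `d_G` is the Hausdorff distance between the
intersections of the subspaces with the closed unit ball. -/
theorem statement6 (H : Type*) [NormedAddCommGroup H] [InnerProductSpace ℝ H]
    [CompleteSpace H] (V W : Submodule ℝ H)
    (hV : IsClosed (V : Set H)) (hW : IsClosed (W : Set H)) :
    hausdorffDist ((Vᗮ : Set H) ∩ closedBall (0 : H) 1) ((Wᗮ : Set H) ∩ closedBall (0 : H) 1)
      = hausdorffDist ((V : Set H) ∩ closedBall (0 : H) 1)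
          ((W : Set H) ∩ closedBall (0 : H) 1) := by
  haveI : CompleteSpace V := hV.completeSpace_coe
  haveI : CompleteSpace W := hW.completeSpace_coe
  refine le_antisymm (gr_le V W) ?_
  have := gr_le Vᗮ Wᗮ
  rwa [Submodule.orthogonal_orthogonal, Submodule.orthogonal_orthogonal] at this
end
end

section
/- Fix integers 1 ≤ k ≤ n and α > 0. There exists c = c(n, α) > 0 with the following property. Let p_0, …, p_k ∈ ℝⁿ α-effectively span the k-dimensional affine subspace V = p_0 + span{p_1 − p_0, …, p_k − p_0}. Then for every x ∈ V there exists a unique tuple (α_1, …, α_k) of real numbers with x = p_0 + Σ_{i=1}^k α_i (p_i − p_0), and moreover |α_i| ≤ c ‖x − p_0‖ for every i. -/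
open MeasureTheory Metric Set

noncomputable section

/-- The affine set `p₀ + span{p_1 - p_0, …, p_i - p_0}` spanned by the first `i` of the
difference vectors of the points `p_0, …, p_k`. -/
def affSpanUpTo (n k : ℕ) (p : Fin (k + 1) → En n) (i : ℕ) : Set (En n) :=
  {y | ∃ v ∈ Submodule.span ℝ {w | ∃ j : Fin k, (j : ℕ) < i ∧ w = p j.succ - p 0},
        y = p 0 + v}

/-- The points `p_0, …, p_k` `α`-effectively span a `k`-dimensional affine subspace:
`‖p_i − p_0‖ ≤ α⁻¹` and `dist(p_i, p_0 + span{p_1 − p_0, …, p_{i-1} − p_0}) > α`. -/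
def EffectivelySpans (n k : ℕ) (α : ℝ) (p : Fin (k + 1) → En n) : Prop :=
  ∀ i : Fin k, ‖p i.succ - p 0‖ ≤ α⁻¹ ∧
    α < Metric.infDist (p i.succ) (affSpanUpTo n k p (i : ℕ))

theorem coord_bound {E : Type*} [NormedAddCommGroup E] [NormedSpace ℝ E] (α : ℝ) (hα : 0 < α) :
    ∀ (k : ℕ) (v : Fin k → E),
      (∀ i, ‖v i‖ ≤ α⁻¹) →
      (∀ i : Fin k, ∀ w ∈ Submodule.span ℝ {w | ∃ j : Fin k, (j : ℕ) < i ∧ w = v j}, α ≤ ‖v i - w‖) →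
      ∀ (a : Fin k → ℝ) (i : Fin k), |a i| ≤ α⁻¹ * (1 + α⁻¹ * α⁻¹) ^ k * ‖∑ j, a j • v j‖ := by
  intro k
  induction k with
  | zero => intro v _ _ a i; exact i.elim0
  | succ k ih =>
    intro v hv hd a i
    have hi : 0 < α⁻¹ := inv_pos.mpr hα
    set q : ℝ := 1 + α⁻¹ * α⁻¹ with hq
    have hq1 : 1 ≤ q := by rw [hq]; nlinarith
    set y : E := ∑ j : Fin k, a j.castSucc • v j.castSucc with hy
    set t : ℝ := a (Fin.last k) with ht
    have hx : ∑ j, a j • v j = y + t • v (Fin.last k) := Fin.sum_univ_castSucc _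
    rw [hx]
    have hymem : y ∈ Submodule.span ℝ
        {w | ∃ j : Fin (k + 1), (j : ℕ) < (Fin.last k : Fin (k+1)) ∧ w = v j} := by
      refine Submodule.sum_mem _ fun j _ => Submodule.smul_mem _ _ (Submodule.subset_span ?_)
      exact ⟨j.castSucc, by simp, rfl⟩
    have hlast : |t| ≤ α⁻¹ * ‖y + t • v (Fin.last k)‖ := by
      by_cases h0 : t = 0
      · rw [h0]; simp; positivity
      · have h1 := hd (Fin.last k) ((-t⁻¹) • y) (Submodule.smul_mem _ _ hymem)
        have h2 : y + t • v (Fin.last k) = t • (v (Fin.last k) - (-t⁻¹) • y) := by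
          rw [smul_sub, smul_smul]
          have : t * -t⁻¹ = -1 := by field_simp
          rw [this]; simp [add_comm]
        rw [h2, norm_smul, Real.norm_eq_abs, inv_mul_eq_div, le_div_iff₀ hα]
        exact mul_le_mul_of_nonneg_left h1 (abs_nonneg t)
    have hN := norm_nonneg (y + t • v (Fin.last k))
    have hyn : ‖y‖ ≤ q * ‖y + t • v (Fin.last k)‖ := by
      have h1 : ‖y‖ ≤ ‖y + t • v (Fin.last k)‖ + ‖t • v (Fin.last k)‖ := by
        simpa using norm_sub_le (y + t • v (Fin.last k)) (t • v (Fin.last k))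
      rw [norm_smul, Real.norm_eq_abs] at h1
      have h2 := mul_le_mul hlast (hv (Fin.last k)) (norm_nonneg _) (by positivity)
      rw [hq]; nlinarith
    refine Fin.lastCases ?_ (fun j => ?_) i
    · refine hlast.trans (mul_le_mul_of_nonneg_right ?_ hN)
      exact le_mul_of_one_le_right hi.le (one_le_pow₀ hq1)
    · have h := ih (fun j => v j.castSucc) (fun j => hv _) (fun i w hw => by
        refine hd i.castSucc w (Submodule.span_mono ?_ hw)
        rintro _ ⟨j, hj, rfl⟩
        exact ⟨j.castSucc, by simpa using hj, rfl⟩) (fun j => a j.castSucc) j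
      refine h.trans ?_
      rw [pow_succ]
      calc _ ≤ α⁻¹ * q ^ k * (q * ‖y + t • v (Fin.last k)‖) :=
            mul_le_mul_of_nonneg_left hyn (by positivity)
        _ = _ := by ring

/-- Lemma 4.7: effectively spanning points give controlled affine
coordinates. -/
theorem statement8 (n : ℕ) (α : ℝ) (hα : 0 < α) :
    ∃ c : ℝ, 0 < c ∧
      ∀ k : ℕ, 1 ≤ k → k ≤ n →
      ∀ p : Fin (k + 1) → En n, EffectivelySpans n k α p →
        ∀ x ∈ affSpanUpTo n k p k,
          ∃ a : Fin k → ℝ,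
            (x = p 0 + ∑ i, a i • (p i.succ - p 0)) ∧
            (∀ i, |a i| ≤ c * ‖x - p 0‖) ∧
            ∀ b : Fin k → ℝ, (x = p 0 + ∑ i, b i • (p i.succ - p 0)) → b = a := by
  have hi : 0 < α⁻¹ := inv_pos.mpr hα
  refine ⟨α⁻¹ * (1 + α⁻¹ * α⁻¹) ^ n, by positivity, ?_⟩
  intro k _ hkn p hp x hx
  have key := coord_bound α hα k (fun i => p i.succ - p 0) (fun i => (hp i).1) (by
    intro i w hw
    have h1 : Metric.infDist (p i.succ) (affSpanUpTo n k p (i : ℕ)) ≤ dist (p i.succ) (p 0 + w) :=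
      Metric.infDist_le_dist_of_mem ⟨w, hw, rfl⟩
    rw [dist_eq_norm, ← sub_sub] at h1
    exact (hp i).2.le.trans h1)
  obtain ⟨v, hv, rfl⟩ := hx
  have hv' : v ∈ Submodule.span ℝ (Set.range fun i : Fin k => p i.succ - p 0) := by
    refine Submodule.span_mono ?_ hv
    rintro _ ⟨j, _, rfl⟩
    exact ⟨j, rfl⟩
  obtain ⟨a, rfl⟩ := (Submodule.mem_span_range_iff_exists_fun ℝ).1 hv'
  refine ⟨a, rfl, fun i => ?_, fun b hb => ?_⟩
  · rw [add_sub_cancel_left]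
    refine (key a i).trans (mul_le_mul_of_nonneg_right ?_ (norm_nonneg _))
    refine mul_le_mul_of_nonneg_left (pow_le_pow_right₀ ?_ hkn) hi.le
    nlinarith
  · have hb' := add_left_cancel hb
    funext i
    have h := key (b - a) i
    have h0 : ∑ j, (b - a) j • (p j.succ - p 0) = 0 := by
      simp only [Pi.sub_apply, sub_smul (b _), Finset.sum_sub_distrib]
      rw [← hb', sub_self]
    rw [h0, norm_zero, mul_zero] at h
    have := abs_eq_zero.1 (le_antisymm h (abs_nonneg _))
    exact sub_eq_zero.1 this
end
end

section
/- Fix integers 1 ≤ k ≤ n, set γ_k := ω_k 40^{-k}, and fix M > 0. There exists ρ_0 = ρ_0(n, k, M) > 0 such that for every 0 < ρ ≤ ρ_0 there is c = c(n, k, ρ, M) > 0 with the following property. Let μ be a finite Borel measure on ℝⁿ with μ(B_1(0)) ≥ γ_k and μ(B_{ρ²}(y)) ≤ M ρ^{2k} for all y ∈ B_1(0), and let B_ρ(x) ⊆ B_1(0) be a ball with μ(B_ρ(x)) ≥ γ_k ρ^k. Let V₁ be any k-dimensional affine subspace minimizing L ↦ ∫_{B_1(0)} dist(y, L)² dμ(y)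 over all k-dimensional affine subspaces of ℝⁿ, and V₂ any k-dimensional affine subspace minimizing L ↦ ∫_{B_ρ(x)} dist(y, L)² dμ(y). If dist(x, V₁ ∩ B_ρ(x)) < ρ/2, then d_H(V₁ ∩ B_ρ(x), V₂ ∩ B_ρ(x))² ≤ c ( D^k_μ(x, ρ) + D^k_μ(0, 1) ). -/
open MeasureTheory Metric Set
open scoped ENNReal NNReal RealInnerProductSpace

noncomputable section

/-- `ε_n = (1000 n)^(-7 n²)`. -/
def epsn (n : ℕ) : ℝ := (1000 * (n : ℝ)) ^ (-(7 * (n : ℤ) ^ 2))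

/-- `ω_k`: the Lebesgue volume of the unit ball in `ℝ^k`. -/
def omegak (k : ℕ) : ℝ := (volume (ball (0 : En k) 1)).toReal

/-- `γ_k = ω_k 40^{-k}`. -/
def gammak (k : ℕ) : ℝ := omegak k * (40 : ℝ)⁻¹ ^ k

/-- The `k`-dimensional displacement `D^k_μ(x,r)` of a measure `μ`. -/
def displ (n k : ℕ) (μ : Measure (En n)) (x : En n) (r : ℝ) : ℝ :=
  if ENNReal.ofReal (epsn n * r ^ k) ≤ μ (ball x r) then
    ⨅ L : {L : AffineSubspace ℝ (En n) // IsAffineSubspaceDim n k L},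
      r ^ (-(k : ℤ) - 2) * ∫ y in ball x r, (Metric.infDist y (L.1 : Set (En n))) ^ 2 ∂μ
  else 0

/-- The displacement `D^k_S` of a set `S`, i.e. of `λ^k` restricted to `S`. -/
def displSet (n k : ℕ) (S : Set (En n)) (x : En n) (r : ℝ) : ℝ :=
  displ n k ((μH[(k : ℝ)] : Measure (En n)).restrict S) x r

/-- `k`-rectifiability: countably many Lipschitz images of `ℝ^k` cover up to `λ^k`-null. -/
def IsRectifiableDim (n k : ℕ) (T : Set (En n)) : Prop :=
  ∃ f : ℕ → (En k → En n),
    (∀ i, ∃ K : ℝ≥0, LipschitzWith K (f i)) ∧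
    μH[(k : ℝ)] (T \ ⋃ i, Set.range (f i)) = 0


lemma card_bound {E : Type*} [NormedAddCommGroup E] [InnerProductSpace ℝ E] [FiniteDimensional ℝ E]
    (s : Finset E) (c : E) (r R : ℝ) (hr : 0 < r) (hR : 0 < R)
    (hs : ∀ p ∈ s, dist p c ≤ R - r) (h : ∀ p ∈ s, ∀ q ∈ s, p ≠ q → 2 * r ≤ dist p q) :
    (s.card : ℝ) * r ^ (Module.finrank ℝ E) ≤ R ^ (Module.finrank ℝ E) := by
  borelize E
  let μ : Measure E := Measure.addHaar
  have hdisj : (s : Set E).PairwiseDisjoint (fun p => ball p r) := by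
    intro p hp q hq hpq
    exact ball_disjoint_ball (by have := h p hp q hq hpq; linarith)
  have hsub : (⋃ p ∈ s, ball p r) ⊆ ball c R := by
    refine iUnion₂_subset fun p hp => ball_subset_ball' ?_
    have := hs p hp; linarith
  have h1 : (s.card : ENNReal) * (ENNReal.ofReal (r ^ Module.finrank ℝ E) * μ (ball 0 1))
      ≤ ENNReal.ofReal (R ^ Module.finrank ℝ E) * μ (ball 0 1) := by
    calc _ = ∑ p ∈ s, μ (ball p r) := by
          simp [Measure.addHaar_ball_of_pos μ _ hr]
      _ = μ (⋃ p ∈ s, ball p r) := (measure_biUnion_finset hdisj fun p _ => measurableSet_ball).symm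
      _ ≤ μ (ball c R) := measure_mono hsub
      _ = _ := Measure.addHaar_ball_of_pos μ _ hR
  rw [← mul_assoc] at h1
  have h0 : μ (ball (0:E) 1) ≠ 0 := (measure_ball_pos _ _ one_pos).ne'
  have ht : μ (ball (0:E) 1) ≠ ⊤ := measure_ball_lt_top.ne
  rw [ENNReal.mul_le_mul_iff_left h0 ht] at h1
  have := ENNReal.toReal_mono (by simp) h1
  simpa [ENNReal.toReal_mul, ENNReal.toReal_ofReal (pow_pos hr _).le, ENNReal.toReal_ofReal (pow_pos hR _).le] using this

/-- counting near a plane -/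
lemma count_near {E : Type*} [NormedAddCommGroup E] [InnerProductSpace ℝ E] [FiniteDimensional ℝ E]
    (W : Submodule ℝ E) (z x : E) (ρ : ℝ) (hρ : 0 < ρ) (hρ1 : ρ ≤ 1) (k : ℕ)
    (hW : Module.finrank ℝ W < k) (s : Finset E)
    (hs : ∀ p ∈ s, p ∈ ball x ρ ∧ ∃ u ∈ W, ‖p - z - u‖ < ρ ^ 2 / 4)
    (h : ∀ p ∈ s, ∀ q ∈ s, p ≠ q → ρ ^ 2 ≤ dist p q) :
    (s.card : ℝ) ≤ (8 / ρ) ^ (k - 1) := by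
  classical
  let P : E → W := fun p => W.orthogonalProjectionOnto (p - z)
  have hP : ∀ p ∈ s, ‖p - z - P p‖ < ρ ^ 2 / 4 := by
    intro p hp
    obtain ⟨-, u, hu, h1⟩ := hs p hp
    refine lt_of_le_of_lt ?_ h1
    change ‖p - z - W.starProjection (p - z)‖ ≤ _
    rw [Submodule.starProjection_minimal]
    exact ciInf_le ⟨0, by rintro _ ⟨y, rfl⟩; positivity⟩ (⟨u, hu⟩ : W)
  have hsep : ∀ p ∈ s, ∀ q ∈ s, p ≠ q → ρ ^ 2 / 2 ≤ dist (P p) (P q) := by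
    intro p hp q hq hpq
    have h1 := hP p hp
    have h2 := hP q hq
    have h3 := h p hp q hq hpq
    rw [Subtype.dist_eq]
    rw [dist_eq_norm] at h3 ⊢
    have h4 : p - q = (p - z - P p) - (q - z - P q) + ((P p : E) - P q) := by abel
    have h5 := norm_add_le ((p - z - P p) - (q - z - P q)) ((P p : E) - P q)
    have h6 := norm_sub_le (p - z - P p : E) (q - z - P q)
    rw [← h4] at h5
    linarith
  have hinj : Set.InjOn P s := by
    intro p hp q hq hpq
    by_contra hne
    have := hsep p hp q hq hne
    rw [hpq, dist_self] at this
    have : 0 < ρ^2 := by positivity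
    linarith
  have hc := card_bound (s.image P) (P x) (ρ ^ 2 / 4) (2 * ρ) (by positivity) (by positivity) ?_ ?_
  · rw [Finset.card_image_of_injOn hinj] at hc
    have h8 : (8 / ρ) ^ (Module.finrank ℝ W) ≤ (8 / ρ) ^ (k - 1) := by
      apply pow_le_pow_right₀ _ (by omega)
      rw [le_div_iff₀ hρ]; linarith
    refine le_trans ?_ h8
    have h9 : (2 * ρ) = (8 / ρ) * (ρ ^ 2 / 4) := by field_simp; norm_num
    rw [h9, mul_pow (8/ρ)] at hc
    exact le_of_mul_le_mul_right hc (by positivity)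
  · intro p' hp'
    obtain ⟨p, hp, rfl⟩ := Finset.mem_image.1 hp'
    have h1 := (hs p hp).1
    rw [mem_ball, dist_eq_norm] at h1
    have : P p - P x = W.orthogonalProjectionOnto (p - x) := by
      simp only [P, ← map_sub]; congr 1; abel
    rw [dist_eq_norm, this]
    have h2 := W.norm_orthogonalProjectionOnto_apply_le (p - x)
    nlinarith
  · intro p' hp' q' hq' hne
    obtain ⟨p, hp, rfl⟩ := Finset.mem_image.1 hp'
    obtain ⟨q, hq, rfl⟩ := Finset.mem_image.1 hq'
    have := hsep p hp q hq (by rintro rfl; exact hne rfl)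
    linarith

lemma exists_net {E : Type*} [PseudoMetricSpace E] (S : Set E) (r B : ℝ) (hr : 0 < r)
    (hB : ∀ s : Finset E, (∀ p ∈ s, p ∈ S) → (∀ p ∈ s, ∀ q ∈ s, p ≠ q → r ≤ dist p q) →
      (s.card : ℝ) ≤ B) :
    ∃ s : Finset E, (∀ p ∈ s, p ∈ S) ∧ (s.card : ℝ) ≤ B ∧ S ⊆ ⋃ p ∈ s, ball p r := by
  classical
  let T : Set ℕ := {m | ∃ s : Finset E, (∀ p ∈ s, p ∈ S) ∧
    (∀ p ∈ s, ∀ q ∈ s, p ≠ q → r ≤ dist p q) ∧ s.card = m}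
  have hne : T.Nonempty := ⟨0, ∅, by simp⟩
  have hbd : BddAbove T := by
    refine ⟨⌊B⌋₊, ?_⟩
    rintro m ⟨s, h1, h2, rfl⟩
    exact Nat.le_floor (hB s h1 h2)
  obtain ⟨s, h1, h2, h3⟩ := Nat.sSup_mem hne hbd
  refine ⟨s, h1, hB s h1 h2, ?_⟩
  intro y hy
  by_contra hcon
  simp only [mem_iUnion, mem_ball, not_exists, not_lt] at hcon
  have hys : y ∉ s := fun hh => by have := hcon y hh; rw [dist_self] at this; linarith
  have : s.card + 1 ∈ T := by
    refine ⟨insert y s, ?_, ?_, Finset.card_insert_of_notMem hys⟩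
    · intro p hp
      rcases Finset.mem_insert.1 hp with rfl | hp
      · exact hy
      · exact h1 p hp
    · intro p hp q hq hpq
      rcases Finset.mem_insert.1 hp with hp' | hp' <;>
        rcases Finset.mem_insert.1 hq with hq' | hq'
      · exact absurd (hp'.trans hq'.symm) hpq
      · rw [hp']; exact hcon q hq'
      · rw [hq', dist_comm]; exact hcon p hp'
      · exact h2 p hp' q hq' hpq
  have := le_csSup hbd this
  omega

def Lam (η R : ℝ) (m : ℕ) : ℝ := (1 / η) * (1 + R / η) ^ m

lemma Lam_pos {η R : ℝ} (hη : 0 < η) (hR : 0 < R) (m : ℕ) : 0 < Lam η R m := by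
  unfold Lam; positivity

lemma exists_indep {E : Type*} [NormedAddCommGroup E] [InnerProductSpace ℝ E]
    (G : Set E) (η R : ℝ) (hη : 0 < η) (hR : 0 < R) (k : ℕ) (hG : ∀ v ∈ G, ‖v‖ ≤ R)
    (H : ∀ W : Submodule ℝ E, Module.finrank ℝ W < k → ∃ v ∈ G, ∀ u ∈ W, η ≤ ‖v - u‖) :
    ∀ m ≤ k, ∃ w : Fin m → E, (∀ i, w i ∈ G) ∧
      ∀ (a : Fin m → ℝ) i, |a i| ≤ Lam η R m * ‖∑ j, a j • w j‖ := by
  intro m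
  induction m with
  | zero => intro _; exact ⟨Fin.elim0, fun i => i.elim0, fun _ i => i.elim0⟩
  | succ m ih =>
    intro hm
    obtain ⟨w, hw, hl⟩ := ih (by omega)
    have hfr : Module.finrank ℝ (Submodule.span ℝ (range w)) < k := by
      have := finrank_range_le_card (R := ℝ) w
      rw [Fintype.card_fin] at this
      exact lt_of_le_of_lt this (by omega)
    obtain ⟨v, hv, hvu⟩ := H _ hfr
    refine ⟨Fin.snoc w v, ?_, ?_⟩
    · intro i
      refine Fin.lastCases ?_ (fun i => ?_) i
      · simpa using hv
      · simpa using hw i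
    · intro a
      have hsum : ∑ j, a j • (Fin.snoc w v : Fin (m+1) → E) j
          = (∑ j : Fin m, a j.castSucc • w j) + a (Fin.last m) • v := by
        rw [Fin.sum_univ_castSucc]; simp
      rw [hsum]
      set A := ∑ j : Fin m, a j.castSucc • w j with hA
      set b := a (Fin.last m) with hb
      set N := ‖A + b • v‖ with hN
      have hAmem : A ∈ Submodule.span ℝ (range w) :=
        Submodule.sum_mem _ fun j _ => Submodule.smul_mem _ _ (Submodule.subset_span ⟨j, rfl⟩)
      have h1 : |b| * η ≤ N := by
        by_cases hb0 : b = 0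
        · rw [hb0]; simp [hN]
        · have h2 := hvu (-(b⁻¹) • A) (Submodule.smul_mem _ _ hAmem)
          have h3 : A + b • v = b • (v - (-(b⁻¹) • A)) := by
            rw [smul_sub, smul_smul]; simp [hb0]; abel
          rw [hN, h3, norm_smul, Real.norm_eq_abs]
          gcongr
      have h1' : |b| ≤ (1/η) * N := by
        rw [one_div, inv_mul_eq_div, le_div_iff₀ hη]; exact h1
      have hN0 : 0 ≤ N := norm_nonneg _
      have h2 : ‖A‖ ≤ (1 + R/η) * N := by
        have h3 : A = (A + b • v) - b • v := by abel
        have h4 := norm_sub_le (A + b • v) (b • v)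
        rw [← h3, norm_smul, Real.norm_eq_abs] at h4
        have h5 : |b| * ‖v‖ ≤ (1/η) * N * R := by
          have := hG v hv
          gcongr
        calc ‖A‖ ≤ N + (1/η) * N * R := by linarith
          _ = _ := by ring
      have hpos : 0 < R / η := by positivity
      intro i
      refine Fin.lastCases ?_ (fun i => ?_) i
      · refine h1'.trans ?_
        unfold Lam
        have : 1 ≤ (1 + R/η)^(m+1) := one_le_pow₀ (by linarith)
        have h6 : 0 < 1/η := by positivity
        gcongr
        nlinarith
      · refine (hl (fun j => a j.castSucc) i).trans ?_
        have := Lam_pos hη hR m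
        calc Lam η R m * ‖A‖ ≤ Lam η R m * ((1 + R/η) * N) := by gcongr
          _ = _ := by unfold Lam; ring


lemma plane_close {E : Type*} [NormedAddCommGroup E] [InnerProductSpace ℝ E]
    [FiniteDimensional ℝ E] (k : ℕ) (V₁ V₂ : AffineSubspace ℝ E)
    (h₁ : Module.finrank ℝ V₁.direction = k) (Λ δ : ℝ) (hΛ : 0 < Λ) (hδ : 0 ≤ δ)
    (hδΛ : 4 * k * δ * Λ ≤ 1)
    (z : E) (w u v : Fin k → E) (u₀ v₀ : E) (hu₀ : u₀ ∈ V₁) (hv₀ : v₀ ∈ V₂)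
    (hu : ∀ i, u i ∈ V₁) (hv : ∀ i, v i ∈ V₂)
    (du₀ : ‖z - u₀‖ ≤ δ) (dv₀ : ‖z - v₀‖ ≤ δ)
    (du : ∀ i, ‖z + w i - u i‖ ≤ δ) (dv : ∀ i, ‖z + w i - v i‖ ≤ δ)
    (hw : ∀ (a : Fin k → ℝ) i, |a i| ≤ Λ * ‖∑ j, a j • w j‖)
    (p : E) (hp : p ∈ V₁) (R : ℝ) (hpR : ‖p - u₀‖ ≤ R) :
    ∃ q ∈ V₂, dist p q ≤ (2 + 8 * k * Λ * R) * δ := by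
  have key : ∀ (a : Fin k → ℝ) i, |a i| ≤ 2 * Λ * ‖∑ j, a j • (u j - u₀)‖ := by
    intro a i
    obtain ⟨i₀, -, hi₀⟩ := Finset.exists_max_image Finset.univ (fun j => |a j|) ⟨i, Finset.mem_univ _⟩
    refine (hi₀ i (Finset.mem_univ _)).trans ?_
    have h1 := hw a i₀
    have h2 : ∑ j, a j • w j = ∑ j, a j • (u j - u₀) + ∑ j, a j • (w j - (u j - u₀)) := by
      rw [← Finset.sum_add_distrib]; congr 1; ext1 j; rw [← smul_add]; congr 1; abel
    have h3 : ‖∑ j, a j • (w j - (u j - u₀))‖ ≤ k * (|a i₀| * (2 * δ)) := by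
      refine (norm_sum_le _ _).trans ?_
      refine (Finset.sum_le_card_nsmul _ _ (|a i₀| * (2 * δ)) ?_).trans (by simp)
      intro j _
      rw [norm_smul, Real.norm_eq_abs]
      have h4 : ‖w j - (u j - u₀)‖ ≤ 2 * δ := by
        have : w j - (u j - u₀) = (z + w j - u j) - (z - u₀) := by abel
        rw [this]
        refine (norm_sub_le _ _).trans ?_
        linarith [du j]
      have := hi₀ j (Finset.mem_univ _)
      gcongr
    have h5 := norm_add_le (∑ j, a j • (u j - u₀)) (∑ j, a j • (w j - (u j - u₀)))
    rw [← h2] at h5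
    have h6 : Λ * ‖∑ j, a j • w j‖ ≤ Λ * (‖∑ j, a j • (u j - u₀)‖ + k * (|a i₀| * (2 * δ))) := by
      gcongr; linarith
    have h7 : (4 * k * δ * Λ) * |a i₀| ≤ 1 * |a i₀| := by gcongr
    nlinarith
  let b : Fin k → V₁.direction := fun i => ⟨u i - u₀, AffineSubspace.vsub_mem_direction (hu i) hu₀⟩
  have hli : LinearIndependent ℝ b := by
    rw [Fintype.linearIndependent_iff]
    intro a ha i
    have h1 : ∑ j, a j • (u j - u₀) = 0 := by
      have := congrArg (Subtype.val) ha
      simpa [b] using this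
    have h2 := key a i
    rw [h1, norm_zero, mul_zero] at h2
    exact abs_eq_zero.1 (le_antisymm h2 (abs_nonneg _))
  have hspan := hli.span_eq_top_of_card_eq_finrank' (by simp [h₁])
  have hpm : (⟨p - u₀, AffineSubspace.vsub_mem_direction hp hu₀⟩ : V₁.direction) ∈
      Submodule.span ℝ (range b) := by rw [hspan]; trivial
  obtain ⟨a, ha⟩ := (Submodule.mem_span_range_iff_exists_fun ℝ).1 hpm
  have ha' : ∑ j, a j • (u j - u₀) = p - u₀ := by
    have := congrArg (Subtype.val) ha
    simpa [b] using this
  have hdir : ∑ j, a j • (v j - v₀) ∈ V₂.direction :=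
    Submodule.sum_mem _ fun j _ => Submodule.smul_mem _ _
      (AffineSubspace.vsub_mem_direction (hv j) hv₀)
  refine ⟨∑ j, a j • (v j - v₀) + v₀, AffineSubspace.vadd_mem_of_mem_direction hdir hv₀, ?_⟩
  have h1 : p - (∑ j, a j • (v j - v₀) + v₀)
      = (u₀ - v₀) + ∑ j, a j • ((u j - u₀) - (v j - v₀)) := by
    simp only [smul_sub (a _) (u _ - u₀), Finset.sum_sub_distrib, ha']
    abel
  rw [dist_eq_norm, h1]
  have h2 : ‖u₀ - v₀‖ ≤ 2 * δ := by
    have : u₀ - v₀ = (z - v₀) - (z - u₀) := by abel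
    rw [this]; refine (norm_sub_le _ _).trans ?_; linarith
  have h3 : ‖∑ j, a j • ((u j - u₀) - (v j - v₀))‖ ≤ k * ((2 * Λ * R) * (4 * δ)) := by
    refine (norm_sum_le _ _).trans ?_
    refine (Finset.sum_le_card_nsmul _ _ ((2 * Λ * R) * (4 * δ)) ?_).trans (by simp)
    intro j _
    rw [norm_smul, Real.norm_eq_abs]
    have h4 : ‖(u j - u₀) - (v j - v₀)‖ ≤ 4 * δ := by
      have : (u j - u₀) - (v j - v₀) = ((z + w j - v j) - (z + w j - u j)) - (u₀ - v₀) := by abel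
      rw [this]
      have e1 := norm_sub_le ((z + w j - v j) - (z + w j - u j)) (u₀ - v₀)
      have e2 := norm_sub_le (z + w j - v j) (z + w j - u j)
      linarith [du j, dv j]
    have h5 := key a j
    rw [ha'] at h5
    have h6 : |a j| ≤ 2 * Λ * R := h5.trans (by gcongr)
    have : 0 ≤ 2 * Λ * R := (abs_nonneg _).trans h6
    gcongr
  refine (norm_add_le _ _).trans ?_
  nlinarith

lemma truncate {E : Type*} [NormedAddCommGroup E] [InnerProductSpace ℝ E]
    (V : AffineSubspace ℝ E) (x c q : E) (ρ d : ℝ) (hρ : 0 < ρ) (hd : 0 ≤ d) (hdρ : d ≤ ρ / 8)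
    (hc : c ∈ V) (hq : q ∈ V) (hcx : dist c x ≤ 5 * ρ / 8) (hqx : dist q x < ρ + d) :
    ∃ q' ∈ (V : Set E) ∩ ball x ρ, dist q q' ≤ 8 * d := by
  set t : ℝ := 4 * d / ρ with ht
  have ht0 : 0 ≤ t := by positivity
  have htρ : t * ρ = 4 * d := by rw [ht]; field_simp
  have ht1 : t ≤ 1 / 2 := by
    rw [ht, div_le_iff₀ hρ]; linarith
  refine ⟨AffineMap.lineMap q c t, ⟨AffineMap.lineMap_mem t hq hc, ?_⟩, ?_⟩
  · rw [mem_ball, dist_eq_norm, AffineMap.lineMap_apply_module]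
    have e : (1 - t) • q + t • c - x = (1 - t) • (q - x) + t • (c - x) := by
      module
    rw [e]
    rw [dist_eq_norm] at hcx hqx
    have h1 := norm_add_le ((1 - t) • (q - x)) (t • (c - x))
    rw [norm_smul, norm_smul, Real.norm_of_nonneg ht0, Real.norm_of_nonneg (by linarith : 0 ≤ 1 - t)] at h1
    have h2 : t * ‖c - x‖ ≤ t * (5 * ρ / 8) := by gcongr
    have h3 : (1 - t) * ‖q - x‖ < (1 - t) * (ρ + d) := by
      apply mul_lt_mul_of_pos_left hqx; linarith
    nlinarith [mul_nonneg ht0 hd]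
  · rw [dist_left_lineMap, Real.norm_of_nonneg ht0]
    have h1 : dist q c ≤ 2 * ρ := by
      have := dist_triangle_right q c x
      linarith
    calc t * dist q c ≤ t * (2 * ρ) := by gcongr
      _ = 8 * d := by linarith

lemma hd_small {E : Type*} [NormedAddCommGroup E] [InnerProductSpace ℝ E]
    (V₁ V₂ : AffineSubspace ℝ E) (x : E) (ρ d : ℝ) (hρ : 0 < ρ) (hd : 0 ≤ d) (hdρ : d ≤ ρ / 8)
    (c : E) (hc : c ∈ V₁) (hcx : dist c x < ρ / 2)
    (h12 : ∀ p ∈ V₁, p ∈ ball x ρ → ∃ q ∈ V₂, dist p q ≤ d)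
    (h21 : ∀ p ∈ V₂, p ∈ ball x ρ → ∃ q ∈ V₁, dist p q ≤ d) :
    hausdorffDist ((V₁ : Set E) ∩ ball x ρ) ((V₂ : Set E) ∩ ball x ρ) ≤ 9 * d := by
  obtain ⟨c', hc', hcc'⟩ := h12 c hc (by rw [mem_ball]; linarith)
  have hc'x : dist c' x ≤ 5 * ρ / 8 := by
    have := dist_triangle_left c' x c
    linarith
  apply hausdorffDist_le_of_mem_dist (by positivity)
  · rintro p ⟨hp, hpx⟩
    obtain ⟨q, hq, hpq⟩ := h12 p hp hpx
    rw [mem_ball] at hpx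
    obtain ⟨q', hq', hqq'⟩ := truncate V₂ x c' q ρ d hρ hd hdρ hc' hq hc'x (by
      have := dist_triangle_left q x p; linarith)
    exact ⟨q', hq', by have := dist_triangle p q q'; linarith⟩
  · rintro p ⟨hp, hpx⟩
    obtain ⟨q, hq, hpq⟩ := h21 p hp hpx
    rw [mem_ball] at hpx
    obtain ⟨q', hq', hqq'⟩ := truncate V₁ x c q ρ d hρ hd hdρ hc hq (by linarith) (by
      have := dist_triangle_left q x p; linarith)
    exact ⟨q', hq', by have := dist_triangle p q q'; linarith⟩

lemma hd_triv {E : Type*} [NormedAddCommGroup E] 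
    (A B : Set E) (x : E) (ρ : ℝ) (hρ : 0 < ρ) :
    hausdorffDist (A ∩ ball x ρ) (B ∩ ball x ρ) ≤ 2 * ρ := by
  rcases (A ∩ ball x ρ).eq_empty_or_nonempty with h | ⟨a, ha⟩
  · rw [h, hausdorffDist_empty']; positivity
  rcases (B ∩ ball x ρ).eq_empty_or_nonempty with h | ⟨b, hb⟩
  · rw [h, hausdorffDist_empty]; positivity
  have key : ∀ p ∈ ball x ρ, ∀ q ∈ ball x ρ, dist p q ≤ 2 * ρ := by
    intro p hp q hq
    rw [mem_ball] at hp hq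
    have := dist_triangle_right p q x; linarith
  exact hausdorffDist_le_of_mem_dist (by positivity) (fun p hp => ⟨b, hb, key p hp.2 b hb.2⟩)
    (fun p hp => ⟨a, ha, key p hp.2 a ha.2⟩)

lemma omegak_ge (k : ℕ) (hk : 1 ≤ k) : (2 / (k : ℝ)) ^ k ≤ omegak k := by
  have hk0 : (0:ℝ) < k := by exact_mod_cast hk
  have h1 : (WithLp.ofLp : En k → (Fin k → ℝ)) ⁻¹' (Set.pi univ fun _ => Ioo (-(1/(k:ℝ))) (1/k))
      ⊆ ball (0 : En k) 1 := by
    intro y hy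
    rw [mem_ball_zero_iff, EuclideanSpace.norm_eq, Real.sqrt_lt' one_pos]
    have hy' : ∀ i, ‖y i‖ ^ 2 < 1 / k := by
      intro i
      have := hy i (mem_univ i)
      have h3 : |y i| < 1 / k := abs_lt.2 this
      have h4 : 1 / (k:ℝ) ≤ 1 := by rw [div_le_one hk0]; exact_mod_cast hk
      rw [Real.norm_eq_abs]
      nlinarith [abs_nonneg (y i)]
    have : Nonempty (Fin k) := ⟨⟨0, hk⟩⟩
    calc ∑ i, ‖y i‖ ^ 2 < ∑ i : Fin k, 1 / (k:ℝ) :=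
          Finset.sum_lt_sum_of_nonempty Finset.univ_nonempty fun i _ => hy' i
      _ = 1 ^ 2 := by simp; field_simp
  have h2 := measure_mono (μ := volume) h1
  rw [(PiLp.volume_preserving_ofLp (Fin k)).measure_preimage
    (MeasurableSet.univ_pi fun _ => measurableSet_Ioo).nullMeasurableSet, Real.volume_pi_Ioo] at h2
  have h3 := ENNReal.toReal_mono measure_ball_lt_top.ne h2
  refine le_trans (le_of_eq ?_) h3
  rw [ENNReal.toReal_prod]
  simp only [sub_neg_eq_add]
  rw [ENNReal.toReal_ofReal (by positivity)]
  simp; congr 1; ring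

lemma gammak_ge (n k : ℕ) (hk : 1 ≤ k) (hkn : k ≤ n) : epsn n ≤ gammak k := by
  have hk0 : (1:ℝ) ≤ k := by exact_mod_cast hk
  have hn0 : (k:ℝ) ≤ n := by exact_mod_cast hkn
  unfold epsn gammak
  calc (1000 * (n : ℝ)) ^ (-(7 * (n : ℤ) ^ 2)) ≤ (1000 * (n : ℝ)) ^ (-(k : ℤ)) := by
        apply zpow_le_zpow_right₀ (by linarith)
        have : (k:ℤ) ≤ n := by exact_mod_cast hkn
        have : (1:ℤ) ≤ n := by omega
        nlinarith
    _ = ((1000 * (n : ℝ))⁻¹) ^ k := by rw [zpow_neg, zpow_natCast, inv_pow]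
    _ ≤ (2 / (k:ℝ) * 40⁻¹) ^ k := by
        gcongr
        rw [inv_le_comm₀ (by linarith) (by positivity)]
        have : (2 / (k:ℝ) * 40⁻¹)⁻¹ = 20 * k := by field_simp; norm_num
        rw [this]; linarith
    _ = (2 / (k:ℝ)) ^ k * 40⁻¹ ^ k := mul_pow _ _ _
    _ ≤ _ := by gcongr; exact omegak_ge k hk

lemma epsn_pos (n : ℕ) (hn : 1 ≤ n) : 0 < epsn n := by
  unfold epsn
  have hk0 : (1:ℝ) ≤ n := by exact_mod_cast hn
  positivity

lemma integrableOn_infDist {n : ℕ} (μ : Measure (En n)) [IsFiniteMeasure μ] (S : Set (En n))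
    (x : En n) (r : ℝ) : IntegrableOn (fun y => infDist y S ^ 2) (ball x r) μ :=
  (((continuous_infDist_pt S).pow 2).continuousOn.integrableOn_compact
    (isCompact_closedBall x r)).mono_set ball_subset_closedBall

lemma displ_ge (n k : ℕ) (hk : 1 ≤ k) (hkn : k ≤ n) (μ : Measure (En n)) (x : En n) (r : ℝ)
    (hr : 0 < r) (hr1 : r ≤ 1) (hμ : ENNReal.ofReal (gammak k * r ^ k) ≤ μ (ball x r))
    (V : AffineSubspace ℝ (En n)) (hV : IsAffineSubspaceDim n k V)
    (hmin : ∀ L : AffineSubspace ℝ (En n), IsAffineSubspaceDim n k L →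
              (∫ y in ball x r, Metric.infDist y (V : Set (En n)) ^ 2 ∂μ)
                ≤ ∫ y in ball x r, Metric.infDist y (L : Set (En n)) ^ 2 ∂μ) :
    (∫ y in ball x r, Metric.infDist y (V : Set (En n)) ^ 2 ∂μ) ≤ displ n k μ x r := by
  have h1 : ENNReal.ofReal (epsn n * r ^ k) ≤ μ (ball x r) := by
    refine le_trans (ENNReal.ofReal_le_ofReal ?_) hμ
    gcongr
    exact gammak_ge n k hk hkn
  rw [displ, if_pos h1]
  have : Nonempty {L : AffineSubspace ℝ (En n) // IsAffineSubspaceDim n k L} := ⟨⟨V, hV⟩⟩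
  refine le_ciInf fun L => ?_
  have h2 : 1 ≤ r ^ (-(k : ℤ) - 2) := by
    apply one_le_zpow_of_nonpos₀ hr hr1; omega
  have h3 := hmin L.1 L.2
  have h4 : 0 ≤ ∫ y in ball x r, Metric.infDist y (L.1 : Set (En n)) ^ 2 ∂μ :=
    integral_nonneg fun _ => by positivity
  nlinarith

lemma measure_step (n k : ℕ) (hk : 1 ≤ k) (M ρ γ : ℝ) (hM : 0 < M) (hγ : 0 < γ)
    (hρ : 0 < ρ) (hρ1 : ρ ≤ 1) (hρ2 : 8 ^ (k - 1) * M * ρ ≤ γ / 4)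
    (μ : Measure (En n)) [IsFiniteMeasure μ]
    (hμ : ∀ y ∈ ball (0 : En n) 1, μ (ball y (ρ ^ 2)) ≤ ENNReal.ofReal (M * ρ ^ (2 * k)))
    (x : En n) (hx : ball x ρ ⊆ ball (0 : En n) 1)
    (hμx : ENNReal.ofReal (γ * ρ ^ k) ≤ μ (ball x ρ))
    (f : En n → ℝ) (hf0 : ∀ y, 0 ≤ f y) (hfi : IntegrableOn f (ball x ρ) μ)
    (s : ℝ) (hs : 0 < s) (hfs : ∫ y in ball x ρ, f y ∂μ ≤ s)
    (z : En n) (W : Submodule ℝ (En n)) (hW : Module.finrank ℝ W < k) :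
    ∃ y ∈ ball x ρ, f y ≤ 4 / (γ * ρ ^ k) * s ∧ ∀ u ∈ W, ρ ^ 2 / 4 ≤ ‖y - z - u‖ := by
  by_contra hcon
  push Not at hcon
  set T := 4 / (γ * ρ ^ k) * s with hT
  have hT0 : 0 < T := by positivity
  have h1 : (μ.restrict (ball x ρ)).real {y | T ≤ f y} ≤ γ * ρ ^ k / 4 := by
    have := mul_meas_ge_le_integral_of_nonneg (μ := μ.restrict (ball x ρ)) (f := f)
      (Filter.Eventually.of_forall hf0) hfi T
    have h2 : T * (μ.restrict (ball x ρ)).real {y | T ≤ f y} ≤ T * (γ * ρ ^ k / 4) := by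
      refine this.trans (hfs.trans (le_of_eq ?_))
      rw [hT]; field_simp
    exact le_of_mul_le_mul_left h2 hT0
  obtain ⟨t, ht1, ht2, ht3⟩ := exists_net {y | y ∈ ball x ρ ∧ ∃ u ∈ W, ‖y - z - u‖ < ρ ^ 2 / 4}
    (ρ ^ 2) ((8 / ρ) ^ (k - 1)) (by positivity)
    (fun t h1 h2 => count_near W z x ρ hρ hρ1 k hW t h1 h2)
  have h2 : μ.real {y | y ∈ ball x ρ ∧ ∃ u ∈ W, ‖y - z - u‖ < ρ ^ 2 / 4} ≤ γ * ρ ^ k / 4 := by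
    calc _ ≤ μ.real (⋃ p ∈ t, ball p (ρ ^ 2)) := measureReal_mono ht3 (measure_ne_top _ _)
      _ ≤ ∑ p ∈ t, μ.real (ball p (ρ ^ 2)) := measureReal_biUnion_finset_le _ _
      _ ≤ ∑ p ∈ t, M * ρ ^ (2 * k) := by
          refine Finset.sum_le_sum fun p hp => ?_
          exact ENNReal.toReal_le_of_le_ofReal (by positivity) (hμ p (hx (ht1 p hp).1))
      _ = t.card * (M * ρ ^ (2 * k)) := by simp
      _ ≤ (8 / ρ) ^ (k - 1) * (M * ρ ^ (2 * k)) := by gcongr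
      _ = (8 ^ (k - 1) * M * ρ) * ρ ^ k := by
          obtain ⟨j, rfl⟩ : ∃ j, k = j + 1 := ⟨k - 1, by omega⟩
          simp only [Nat.add_sub_cancel]
          rw [div_pow, show 2 * (j + 1) = j + (j + 2) by ring, pow_add]
          field_simp
          ring
      _ ≤ γ / 4 * ρ ^ k := by gcongr
      _ = _ := by ring
  have h3 : γ * ρ ^ k ≤ μ.real (ball x ρ) :=
    (ENNReal.ofReal_le_iff_le_toReal (measure_ne_top _ _)).1 hμx
  have h4 : μ.real (ball x ρ) = (μ.restrict (ball x ρ)).real (ball x ρ) := by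
    simp [measureReal_def]
  have h5 : (μ.restrict (ball x ρ)).real (ball x ρ) ≤
      (μ.restrict (ball x ρ)).real ({y | T ≤ f y} ∪
        {y | y ∈ ball x ρ ∧ ∃ u ∈ W, ‖y - z - u‖ < ρ ^ 2 / 4}) := by
    refine measureReal_mono ?_ (measure_ne_top _ _)
    intro y hy
    by_cases hfy : f y ≤ T
    · exact Or.inr ⟨hy, hcon y hy hfy⟩
    · exact Or.inl (not_le.1 hfy).le
  have h6 := measureReal_union_le (μ := μ.restrict (ball x ρ)) {y | T ≤ f y}
    {y | y ∈ ball x ρ ∧ ∃ u ∈ W, ‖y - z - u‖ < ρ ^ 2 / 4}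
  have h7 : (μ.restrict (ball x ρ)).real {y | y ∈ ball x ρ ∧ ∃ u ∈ W, ‖y - z - u‖ < ρ ^ 2 / 4}
      ≤ μ.real {y | y ∈ ball x ρ ∧ ∃ u ∈ W, ‖y - z - u‖ < ρ ^ 2 / 4} :=
    ENNReal.toReal_mono (measure_ne_top _ _) (Measure.restrict_apply_le _ _)
  have : 0 < γ * ρ ^ k := by positivity
  linarith

lemma core (n k : ℕ) (hk : 1 ≤ k) (M ρ γ : ℝ) (hM : 0 < M) (hγ : 0 < γ)
    (hρ : 0 < ρ) (hρ1 : ρ ≤ 1) (hρ2 : 8 ^ (k - 1) * M * ρ ≤ γ / 4)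
    (Λ : ℝ) (hΛ : Λ = Lam (ρ ^ 2 / 4) 2 k) (C : ℝ) (hC : C = 2 + 8 * k * Λ * 3)
    (μ : Measure (En n)) [IsFiniteMeasure μ]
    (hμ : ∀ y ∈ ball (0 : En n) 1, μ (ball y (ρ ^ 2)) ≤ ENNReal.ofReal (M * ρ ^ (2 * k)))
    (x : En n) (hx : ball x ρ ⊆ ball (0 : En n) 1)
    (hμx : ENNReal.ofReal (γ * ρ ^ k) ≤ μ (ball x ρ))
    (V₁ V₂ : AffineSubspace ℝ (En n)) (hV₁ : IsAffineSubspaceDim n k V₁)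
    (hV₂ : IsAffineSubspaceDim n k V₂)
    (s : ℝ) (hs : 0 < s)
    (hfs : ∫ y in ball x ρ, infDist y (V₁ : Set (En n)) ^ 2 ∂μ +
      ∫ y in ball x ρ, infDist y (V₂ : Set (En n)) ^ 2 ∂μ ≤ s)
    (c : En n) (hc : c ∈ V₁) (hcx : dist c x < ρ / 2)
    (δ : ℝ) (hδ : 0 ≤ δ) (hδs : δ ^ 2 = 4 / (γ * ρ ^ k) * s)
    (hδ1 : δ ≤ 1) (hδ2 : 4 * k * δ * Λ ≤ 1) (hδ3 : C * δ ≤ ρ / 8) :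
    hausdorffDist ((V₁ : Set (En n)) ∩ ball x ρ) ((V₂ : Set (En n)) ∩ ball x ρ) ≤ 9 * (C * δ) := by
  set f : En n → ℝ := fun y => infDist y (V₁ : Set (En n)) ^ 2 + infDist y (V₂ : Set (En n)) ^ 2
    with hf
  have hi₁ := integrableOn_infDist μ (V₁ : Set (En n)) x ρ
  have hi₂ := integrableOn_infDist μ (V₂ : Set (En n)) x ρ
  have hfi : IntegrableOn f (ball x ρ) μ := hi₁.add hi₂
  have hfs' : ∫ y in ball x ρ, f y ∂μ ≤ s := by
    rw [hf, integral_add hi₁ hi₂]; exact hfs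
  have step := fun z W hW => measure_step n k hk M ρ γ hM hγ hρ hρ1 hρ2 μ hμ x hx hμx f
    (fun y => by positivity) hfi s hs hfs' z W hW
  rw [← hδs] at step
  obtain ⟨z, hz, hfz, -⟩ := step 0 ⊥ (by simp; omega)
  have hηpos : 0 < ρ ^ 2 / 4 := by positivity
  have hΛ0 : 0 < Λ := by rw [hΛ]; exact Lam_pos hηpos two_pos k
  obtain ⟨w, hw, hwl⟩ := exists_indep {v | z + v ∈ ball x ρ ∧ f (z + v) ≤ δ ^ 2} (ρ ^ 2 / 4) 2
    hηpos two_pos k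
    (by
      rintro v ⟨hv, -⟩
      rw [mem_ball] at hv hz
      have h1 := dist_triangle_right (z + v) z x
      have h2 : dist (z + v) z = ‖v‖ := by rw [dist_eq_norm]; congr 1; abel
      linarith)
    (by
      intro W hW
      obtain ⟨y, hy, hfy, hyW⟩ := step z W hW
      exact ⟨y - z, by simpa using ⟨hy, hfy⟩, hyW⟩) k le_rfl
  rw [← hΛ] at hwl
  have near₁ : ∀ y, f y ≤ δ ^ 2 → ∃ u ∈ V₁, ‖y - u‖ ≤ δ := by
    intro y hy
    obtain ⟨u, hu, hyu⟩ := (AffineSubspace.closed_of_finiteDimensional V₁).exists_infDist_eq_dist hV₁.1 y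
    refine ⟨u, hu, ?_⟩
    rw [← dist_eq_norm, ← hyu]
    apply le_of_sq_le_sq _ hδ
    have : 0 ≤ infDist y (V₂ : Set (En n)) ^ 2 := by positivity
    simp only [hf] at hy
    linarith
  have near₂ : ∀ y, f y ≤ δ ^ 2 → ∃ u ∈ V₂, ‖y - u‖ ≤ δ := by
    intro y hy
    obtain ⟨u, hu, hyu⟩ := (AffineSubspace.closed_of_finiteDimensional V₂).exists_infDist_eq_dist hV₂.1 y
    refine ⟨u, hu, ?_⟩
    rw [← dist_eq_norm, ← hyu]
    apply le_of_sq_le_sq _ hδ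
    have : 0 ≤ infDist y (V₁ : Set (En n)) ^ 2 := by positivity
    simp only [hf] at hy
    linarith
  obtain ⟨u₀, hu₀, du₀⟩ := near₁ z hfz
  obtain ⟨v₀, hv₀, dv₀⟩ := near₂ z hfz
  choose u hu du using fun i => near₁ (z + w i) (hw i).2
  choose v hv dv using fun i => near₂ (z + w i) (hw i).2
  have hR : ∀ u₀ : En n, ‖z - u₀‖ ≤ δ → ∀ p ∈ ball x ρ, ‖p - u₀‖ ≤ 3 := by
    intro u₀ du₀ p hp
    rw [mem_ball] at hp hz
    have h1 := dist_triangle_right p z x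
    have h2 := dist_triangle p z u₀
    rw [← dist_eq_norm] at du₀ ⊢
    linarith
  have hC0 : 0 ≤ C := by rw [hC]; positivity
  apply hd_small V₁ V₂ x ρ (C * δ) hρ (by positivity) hδ3 c hc hcx
  · intro p hp hpx
    rw [hC]
    exact plane_close k V₁ V₂ hV₁.2 Λ δ hΛ0 hδ hδ2 z w u v u₀ v₀ hu₀ hv₀ hu hv du₀ dv₀ du dv hwl
      p hp 3 (hR u₀ du₀ p hpx)
  · intro p hp hpx
    rw [hC]
    exact plane_close k V₂ V₁ hV₂.2 Λ δ hΛ0 hδ hδ2 z w v u v₀ u₀ hv₀ hu₀ hv hu dv₀ du₀ dv du hwl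
      p hp 3 (hR v₀ dv₀ p hpx)

/-- Lemma 4.11: distance between `L²`-best planes at nearby scales. -/
theorem statement10 (n k : ℕ) (hk : 1 ≤ k) (hkn : k ≤ n) (M : ℝ) (hM : 0 < M) :
    ∃ ρ₀ : ℝ, 0 < ρ₀ ∧
      ∀ ρ : ℝ, 0 < ρ → ρ ≤ ρ₀ →
      ∃ c : ℝ, 0 < c ∧
        ∀ μ : Measure (En n), IsFiniteMeasure μ →
          ENNReal.ofReal (gammak k) ≤ μ (ball (0 : En n) 1) →
          (∀ y ∈ ball (0 : En n) 1, μ (ball y (ρ ^ 2)) ≤ ENNReal.ofReal (M * ρ ^ (2 * k))) →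
          ∀ x : En n, ball x ρ ⊆ ball (0 : En n) 1 →
            ENNReal.ofReal (gammak k * ρ ^ k) ≤ μ (ball x ρ) →
          ∀ V₁ V₂ : AffineSubspace ℝ (En n),
            IsAffineSubspaceDim n k V₁ →
            (∀ L : AffineSubspace ℝ (En n), IsAffineSubspaceDim n k L →
              (∫ y in ball (0 : En n) 1, Metric.infDist y (V₁ : Set (En n)) ^ 2 ∂μ)
                ≤ ∫ y in ball (0 : En n) 1, Metric.infDist y (L : Set (En n)) ^ 2 ∂μ) →
            IsAffineSubspaceDim n k V₂ →
            (∀ L : AffineSubspace ℝ (En n), IsAffineSubspaceDim n k L →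
              (∫ y in ball x ρ, Metric.infDist y (V₂ : Set (En n)) ^ 2 ∂μ)
                ≤ ∫ y in ball x ρ, Metric.infDist y (L : Set (En n)) ^ 2 ∂μ) →
            Metric.infDist x ((V₁ : Set (En n)) ∩ ball x ρ) < ρ / 2 →
            hausdorffDist ((V₁ : Set (En n)) ∩ ball x ρ) ((V₂ : Set (En n)) ∩ ball x ρ) ^ 2
              ≤ c * (displ n k μ x ρ + displ n k μ 0 1) := by
  have hγ : 0 < gammak k := (epsn_pos n (by omega)).trans_le (gammak_ge n k hk hkn)
  set γ := gammak k with hγdef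
  have hk0 : (0:ℝ) < k := by exact_mod_cast hk
  refine ⟨min 1 (γ / (4 * (8 ^ (k - 1) * M))), by positivity, ?_⟩
  intro ρ hρ hρ0
  have hρ1 : ρ ≤ 1 := hρ0.trans (min_le_left _ _)
  have hρ2 : 8 ^ (k - 1) * M * ρ ≤ γ / 4 := by
    have := hρ0.trans (min_le_right _ _)
    rw [le_div_iff₀ (by positivity)] at this
    linarith
  obtain ⟨Λ, hΛ⟩ : ∃ Λ, Λ = Lam (ρ ^ 2 / 4) 2 k := ⟨_, rfl⟩
  have hΛ0 : 0 < Λ := by rw [hΛ]; exact Lam_pos (by positivity) two_pos k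
  obtain ⟨C, hC⟩ : ∃ C : ℝ, C = 2 + 8 * k * Λ * 3 := ⟨_, rfl⟩
  have hC0 : 0 < C := by rw [hC]; positivity
  obtain ⟨δ₀, hδ₀⟩ : ∃ δ₀ : ℝ, δ₀ = min 1 (min (1 / (4 * k * Λ)) (ρ / (8 * C))) := ⟨_, rfl⟩
  have hδ₀0 : 0 < δ₀ := by rw [hδ₀]; positivity
  obtain ⟨K, hK⟩ : ∃ K : ℝ, K = 4 / (γ * ρ ^ k) := ⟨_, rfl⟩
  have hK0 : 0 < K := by rw [hK]; positivity
  refine ⟨81 * C ^ 2 * K + 4 * K / δ₀ ^ 2, by positivity, ?_⟩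
  intro μ hfin hμ1 hμ x hx hμx V₁ V₂ hV₁ hmin₁ hV₂ hmin₂ hdist
  have d2 := displ_ge n k hk hkn μ x ρ hρ hρ1 hμx V₂ hV₂ hmin₂
  have d1 := displ_ge n k hk hkn μ 0 1 one_pos le_rfl (by simpa using hμ1) V₁ hV₁ hmin₁
  have d1' : ∫ y in ball x ρ, infDist y (V₁ : Set (En n)) ^ 2 ∂μ
      ≤ ∫ y in ball (0 : En n) 1, infDist y (V₁ : Set (En n)) ^ 2 ∂μ :=
    setIntegral_mono_set (integrableOn_infDist μ _ 0 1)
      (Filter.Eventually.of_forall fun y => by positivity) (Filter.Eventually.of_forall hx)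
  have n1 : 0 ≤ ∫ y in ball x ρ, infDist y (V₁ : Set (En n)) ^ 2 ∂μ :=
    integral_nonneg fun _ => by positivity
  have n2 : 0 ≤ ∫ y in ball x ρ, infDist y (V₂ : Set (En n)) ^ 2 ∂μ :=
    integral_nonneg fun _ => by positivity
  set S := displ n k μ x ρ + displ n k μ 0 1 with hS
  have hS0 : 0 ≤ S := by linarith
  rcases ((V₁ : Set (En n)) ∩ ball x ρ).eq_empty_or_nonempty with he | hne
  · rw [he, hausdorffDist_empty']
    have : 0 ≤ (81 * C ^ 2 * K + 4 * K / δ₀ ^ 2) * S := by positivity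
    simpa using this
  obtain ⟨c, ⟨hc, -⟩, hcx⟩ := (infDist_lt_iff hne).1 hdist
  rw [dist_comm] at hcx
  set h := hausdorffDist ((V₁ : Set (En n)) ∩ ball x ρ) ((V₂ : Set (En n)) ∩ ball x ρ) with hh
  have hh0 : 0 ≤ h := hausdorffDist_nonneg
  have main : ∀ s, S < s → h ^ 2 ≤ (81 * C ^ 2 * K + 4 * K / δ₀ ^ 2) * s := by
    intro s hSs
    have hs : 0 < s := by linarith
    have hδs : √(K * s) ^ 2 = K * s := Real.sq_sqrt (by positivity)
    have hδ : 0 ≤ √(K * s) := Real.sqrt_nonneg _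
    set δ := √(K * s)
    rw [add_mul]
    have p1 : 0 ≤ 81 * C ^ 2 * K * s := by positivity
    have p2 : 0 ≤ 4 * K / δ₀ ^ 2 * s := by positivity
    by_cases hcase : δ ≤ δ₀
    · have q1 : δ ≤ 1 := hcase.trans (by rw [hδ₀]; exact min_le_left _ _)
      have q2 : δ ≤ 1 / (4 * k * Λ) :=
        hcase.trans (by rw [hδ₀]; exact (min_le_right _ _).trans (min_le_left _ _))
      have q3 : δ ≤ ρ / (8 * C) :=
        hcase.trans (by rw [hδ₀]; exact (min_le_right _ _).trans (min_le_right _ _))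
      rw [le_div_iff₀ (by positivity)] at q2 q3
      have := core n k hk M ρ γ hM hγ hρ hρ1 hρ2 Λ hΛ C hC μ hμ x hx hμx V₁ V₂ hV₁ hV₂ s hs
        (by linarith) c hc hcx δ hδ (by rw [hδs, hK]) q1 (by linarith) (by linarith)
      have h2 : h ^ 2 ≤ (9 * (C * δ)) ^ 2 := by gcongr
      have h3 : (9 * (C * δ)) ^ 2 = 81 * C ^ 2 * K * s := by
        rw [mul_pow, mul_pow, hδs]; ring
      linarith
    · push Not at hcase
      have := hd_triv (V₁ : Set (En n)) (V₂ : Set (En n)) x ρ hρ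
      have h2 : h ^ 2 ≤ 2 ^ 2 := by gcongr; linarith
      have h3 : δ₀ ^ 2 ≤ K * s := by rw [← hδs]; gcongr
      have h4 : 4 ≤ 4 * K / δ₀ ^ 2 * s := by
        rw [div_mul_eq_mul_div, le_div_iff₀ (by positivity)]; linarith
      linarith
  set c' := 81 * C ^ 2 * K + 4 * K / δ₀ ^ 2 with hc'
  have hc'0 : 0 < c' := by positivity
  apply le_of_forall_pos_le_add
  intro ε hε
  have h1 := main (S + ε / c') (by have : 0 < ε / c' := by positivity
                                   linarith)
  have h2 : c' * (S + ε / c') = c' * S + ε := by field_simp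
  linarith
end
end

section
/- Let μ be a Borel probability measure on ℝⁿ supported in B_1(0), with center of mass x_cm := ∫ x dμ(x). Let (v_1, …, v_n) be an orthonormal basis of ℝⁿ and λ_1, …, λ_n ≥ 0 be such that for each j: λ_j = ∫ ⟨x − x_cm, v_j⟩² dμ(x), and for every unit vector v ∈ ℝⁿ orthogonal to v_1, …, v_{j-1} one has ∫ ⟨x − x_cm, v⟩² dμ(x) ≤ λ_j. Then for each 0 ≤ k ≤ n, setting V^k := x_cm + span{v_1, …, v_k}, the infimum over all k-dimensional affine subspaces L ⊆ ℝⁿ of ∫ dist(x, L)² dμ(x) is attained at V^k, and ∫ dist(x, V^k)² dμ(x) = λ_{k+1} + ⋯ + λ_n. -/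
open MeasureTheory Metric Set
open scoped RealInnerProductSpace

noncomputable section

lemma aux_infDist {n : ℕ} {ι : Type*} [Fintype ι] (u : ι → En n) (hu : Orthonormal ℝ u)
    (S : Set (En n)) (p : En n) (hS : ∀ y, y ∈ S ↔ ∀ i, ⟪y - p, u i⟫ = 0) (x : En n) :
    Metric.infDist x S ^ 2 = ∑ i, ⟪x - p, u i⟫ ^ 2 := by
  classical
  have hp : p ∈ S := by rw [hS]; simp
  set z : En n := ∑ i, ⟪x - p, u i⟫ • u i with hz
  have hzu : ∀ i, ⟪z, u i⟫ = ⟪x - p, u i⟫ := by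
    intro i
    have := hu.inner_left_fintype (fun i => ⟪x - p, u i⟫) i
    simpa using this
  have hzn : ‖z‖ ^ 2 = ∑ i, ⟪x - p, u i⟫ ^ 2 := by
    rw [← real_inner_self_eq_norm_sq]
    conv_lhs => rw [hz]
    rw [← hz, sum_inner]
    refine Finset.sum_congr rfl fun i _ => ?_
    rw [real_inner_smul_left, real_inner_comm z (u i), hzu]; ring
  rw [← hzn]
  congr 1
  apply le_antisymm
  · have hy : x - z ∈ S := by
      rw [hS]; intro i
      have : x - z - p = (x - p) - z := by abel
      rw [this, inner_sub_left, hzu, sub_self]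
    have := Metric.infDist_le_dist_of_mem (x := x) hy
    rwa [dist_eq_norm, sub_sub_cancel] at this
  · rw [Metric.le_infDist ⟨p, hp⟩]
    intro y hy
    rw [dist_eq_norm]
    refine (sq_le_sq₀ (norm_nonneg _) (norm_nonneg _)).1 ?_
    rw [hzn]
    have hb := hu.sum_inner_products_le (x - y) (s := Finset.univ)
    refine le_trans (le_of_eq ?_) hb
    refine Finset.sum_congr rfl fun i _ => ?_
    have h0 := (hS y).1 hy i
    have : x - p = (x - y) + (y - p) := by abel
    rw [this, inner_add_left, h0, add_zero, Real.norm_eq_abs, sq_abs, real_inner_comm]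

lemma aux_int {n : ℕ} (μ : Measure (En n)) [IsProbabilityMeasure μ]
    (hsupp : μ ((ball (0 : En n) 1)ᶜ) = 0) (p q a b : En n) :
    Integrable (fun x => ⟪x - p, a⟫ * ⟪x - q, b⟫) μ := by
  apply Integrable.of_bound (C := ((1 + ‖p‖) * ‖a‖) * ((1 + ‖q‖) * ‖b‖))
  · exact (by fun_prop : Continuous fun x : En n => ⟪x - p, a⟫ * ⟪x - q, b⟫).aestronglyMeasurable
  · have : ∀ᵐ x ∂μ, x ∈ ball (0 : En n) 1 := by
      rw [ae_iff]; exact hsupp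
    filter_upwards [this] with x hx
    have hx' : ‖x‖ ≤ 1 := by simpa using (mem_ball_zero_iff.1 hx).le
    have key : ∀ p a : En n, ‖⟪x - p, a⟫‖ ≤ (1 + ‖p‖) * ‖a‖ := by
      intro p a
      refine (norm_inner_le_norm _ _).trans ?_
      gcongr
      exact (norm_sub_le _ _).trans (by linarith)
    rw [norm_mul]
    exact mul_le_mul (key p a) (key q b) (norm_nonneg _) (by positivity)

lemma aux_int1 {n : ℕ} (μ : Measure (En n)) [IsProbabilityMeasure μ]
    (hsupp : μ ((ball (0 : En n) 1)ᶜ) = 0) : Integrable (fun x : En n => x) μ := by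
  apply Integrable.of_bound (C := 1)
  · exact continuous_id.aestronglyMeasurable
  · have : ∀ᵐ x ∂μ, x ∈ ball (0 : En n) 1 := by
      rw [ae_iff]; exact hsupp
    filter_upwards [this] with x hx
    exact (mem_ball_zero_iff.1 hx).le

lemma aux_var {n : ℕ} (μ : Measure (En n)) [IsProbabilityMeasure μ]
    (hsupp : μ ((ball (0 : En n) 1)ᶜ) = 0) (xcm : En n) (hxcm : xcm = ∫ z, z ∂μ) (p a : En n) :
    ∫ x, ⟪x - xcm, a⟫ ^ 2 ∂μ ≤ ∫ x, ⟪x - p, a⟫ ^ 2 ∂μ := by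
  have hi : Integrable (fun x => ⟪x - xcm, a⟫ ^ 2) μ := by
    simpa [sq] using aux_int μ hsupp xcm xcm a a
  have hl : Integrable (fun x : En n => x - xcm) μ :=
    (aux_int1 μ hsupp).sub (integrable_const _)
  have hl' : Integrable (fun x : En n => ⟪x - xcm, a⟫) μ := hl.inner_const a
  have h0 : ∫ x, ⟪x - xcm, a⟫ ∂μ = 0 := by
    have h1 : ∫ x, (x - xcm) ∂μ = 0 := by
      rw [integral_sub (aux_int1 μ hsupp) (integrable_const _), ← hxcm]; simp
    have h2 := integral_inner (𝕜 := ℝ) hl a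
    rw [h1, inner_zero_right] at h2
    rw [← h2]
    exact integral_congr_ae (Filter.Eventually.of_forall fun x => real_inner_comm _ _)
  have e : ∀ x, ⟪x - p, a⟫ ^ 2 = ⟪x - xcm, a⟫ ^ 2 +
      (2 * ⟪xcm - p, a⟫ * ⟪x - xcm, a⟫ + ⟪xcm - p, a⟫ ^ 2) := by
    intro x
    have : x - p = (x - xcm) + (xcm - p) := by abel
    rw [this, inner_add_left]; ring
  have hs : Integrable (fun x => 2 * ⟪xcm - p, a⟫ * ⟪x - xcm, a⟫ + ⟪xcm - p, a⟫ ^ 2) μ :=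
    (hl'.const_mul _).add (integrable_const _)
  rw [integral_congr_ae (Filter.Eventually.of_forall e)]
  rw [integral_add hi hs,
    integral_add (hl'.const_mul _) (integrable_const _), integral_const_mul, h0]
  simp
  positivity

lemma aux_B {n : ℕ} (μ : Measure (En n)) [IsProbabilityMeasure μ]
    (hsupp : μ ((ball (0 : En n) 1)ᶜ) = 0)
    (xcm : En n)
    (v : OrthonormalBasis (Fin n) ℝ (En n))
    (lam : Fin n → ℝ)
    (hlam : ∀ j, lam j = ∫ x, ⟪x - xcm, v j⟫ ^ 2 ∂μ)
    (hmax : ∀ j : Fin n, ∀ w : En n, ‖w‖ = 1 → (∀ i : Fin n, i < j → ⟪w, v i⟫ = 0) →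
      (∫ x, ⟪x - xcm, w⟫ ^ 2 ∂μ) ≤ lam j) (i j : Fin n) (hij : i < j) :
    ∫ x, ⟪x - xcm, v i⟫ * ⟪x - xcm, v j⟫ ∂μ = 0 := by
  set B := ∫ x, ⟪x - xcm, v i⟫ * ⟪x - xcm, v j⟫ ∂μ with hB
  have hv := orthonormal_iff_ite.1 v.orthonormal
  have key : ∀ t : ℝ, 2 * t * B + t ^ 2 * lam j ≤ t ^ 2 * lam i := by
    intro t
    set w := v i + t • v j with hw
    have hwn : ‖w‖ ^ 2 = 1 + t ^ 2 := by
      rw [← real_inner_self_eq_norm_sq, hw]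
      simp only [inner_add_left, inner_add_right, real_inner_smul_left, real_inner_smul_right, hv]
      simp [hij.ne, hij.ne']; ring
    have hpos : 0 < ‖w‖ := by
      have := norm_nonneg w
      rcases this.lt_or_eq with h | h
      · exact h
      · rw [← h] at hwn; nlinarith [sq_nonneg t]
    have h1 := hmax i (‖w‖⁻¹ • w) (by rw [norm_smul, norm_inv, norm_norm, inv_mul_cancel₀ hpos.ne'])
      (by
        intro l hl
        rw [real_inner_smul_left, hw, inner_add_left, real_inner_smul_left, hv, hv]
        simp [hl.ne', (hl.trans hij).ne'])
    simp_rw [real_inner_smul_right, mul_pow] at h1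
    rw [integral_const_mul] at h1
    have h2 : ∫ x, ⟪x - xcm, w⟫ ^ 2 ∂μ = lam i + (2 * t * B + t ^ 2 * lam j) := by
      have e : ∀ x, ⟪x - xcm, w⟫ ^ 2 = ⟪x - xcm, v i⟫ ^ 2 +
          (2 * t * (⟪x - xcm, v i⟫ * ⟪x - xcm, v j⟫) + t ^ 2 * ⟪x - xcm, v j⟫ ^ 2) := by
        intro x
        rw [hw, inner_add_right, real_inner_smul_right]; ring
      have hi : ∀ i, Integrable (fun x => ⟪x - xcm, v i⟫ ^ 2) μ := fun i => by
        simpa [sq] using aux_int μ hsupp xcm xcm (v i) (v i)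
      have hc := aux_int μ hsupp xcm xcm (v i) (v j)
      have hs : Integrable (fun x => 2 * t * (⟪x - xcm, v i⟫ * ⟪x - xcm, v j⟫) +
          t ^ 2 * ⟪x - xcm, v j⟫ ^ 2) μ := (hc.const_mul _).add ((hi j).const_mul _)
      simp_rw [e]
      rw [integral_add (hi i) hs,
        integral_add (hc.const_mul _) ((hi j).const_mul _), integral_const_mul,
        integral_const_mul, ← hlam, ← hlam]
    rw [h2, inv_pow, hwn, inv_mul_le_iff₀ (by positivity)] at h1
    linarith
  have h1 := key
  by_contra hne
  set D := lam i - lam j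
  have k : ∀ t : ℝ, 2 * t * B ≤ t ^ 2 * D := fun t => by
    have := key t; simp only [D]; linarith
  have hD : 0 ≤ D := by have a := k 1; have b := k (-1); linarith
  have hk := k (B / (D + 1))
  have hd : 0 < D + 1 := by linarith
  rw [div_pow, mul_div_assoc', div_mul_eq_mul_div, div_mul_eq_mul_div,
    div_le_div_iff₀ hd (by positivity)] at hk
  have hBB : 0 < B ^ 2 := by positivity
  have : 2 * (D + 1) ≤ D := by
    have h3 : (B ^ 2 * (D + 1)) * (2 * (D + 1)) ≤ (B ^ 2 * (D + 1)) * D := by nlinarith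
    exact le_of_mul_le_mul_left h3 (by positivity)
  linarith

lemma aux_Q {n : ℕ} (μ : Measure (En n)) [IsProbabilityMeasure μ]
    (hsupp : μ ((ball (0 : En n) 1)ᶜ) = 0)
    (xcm : En n)
    (v : OrthonormalBasis (Fin n) ℝ (En n))
    (lam : Fin n → ℝ)
    (hlam : ∀ j, lam j = ∫ x, ⟪x - xcm, v j⟫ ^ 2 ∂μ)
    (hB : ∀ i j : Fin n, i < j → ∫ x, ⟪x - xcm, v i⟫ * ⟪x - xcm, v j⟫ ∂μ = 0) (u : En n) :
    ∫ x, ⟪x - xcm, u⟫ ^ 2 ∂μ = ∑ j, lam j * ⟪u, v j⟫ ^ 2 := by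
  have hB' : ∀ i j : Fin n, ∫ x, ⟪x - xcm, v i⟫ * ⟪x - xcm, v j⟫ ∂μ =
      if i = j then lam i else 0 := by
    intro i j
    rcases lt_trichotomy i j with h | h | h
    · rw [hB i j h, if_neg h.ne]
    · subst h; rw [if_pos rfl, hlam]; simp_rw [sq]
    · rw [if_neg h.ne', ← hB j i h]; simp_rw [mul_comm]
  have e : ∀ x, ⟪x - xcm, u⟫ ^ 2 = ∑ i, ∑ j, (⟪u, v i⟫ * ⟪u, v j⟫) *
      (⟪x - xcm, v i⟫ * ⟪x - xcm, v j⟫) := by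
    intro x
    rw [← v.sum_inner_mul_inner (x - xcm) u, sq, Finset.sum_mul_sum]
    refine Finset.sum_congr rfl fun i _ => Finset.sum_congr rfl fun j _ => ?_
    rw [real_inner_comm u (v i), real_inner_comm u (v j)]; ring
  simp_rw [e]
  have hi := fun i j => aux_int μ hsupp xcm xcm (v i) (v j)
  rw [integral_finsetSum _ (fun i _ => integrable_finsetSum _ fun j _ => (hi i j).const_mul _)]
  refine Finset.sum_congr rfl fun i _ => ?_
  rw [integral_finsetSum _ (fun j _ => (hi i j).const_mul _)]
  simp_rw [integral_const_mul, hB']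
  simp; ring

lemma aux_comb {n : ℕ} (k : ℕ) (hk : k ≤ n) (lam c : Fin n → ℝ) (hl : ∀ j, 0 ≤ lam j)
    (hanti : ∀ i j, i < j → lam j ≤ lam i) (h0 : ∀ j, 0 ≤ c j) (h1 : ∀ j, c j ≤ 1)
    (hs : ∑ j, c j = (n : ℝ) - k) :
    ∑ j : Fin n, (if k ≤ (j : ℕ) then lam j else 0) ≤ ∑ j, lam j * c j := by
  rcases hk.eq_or_lt with rfl | hk
  · refine Finset.sum_le_sum fun j _ => ?_
    rw [if_neg (by have := j.2; omega)]
    exact mul_nonneg (hl j) (h0 j)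
  · set d : Fin n → ℝ := fun j => if k ≤ (j : ℕ) then 1 else 0 with hd
    have hsd : ∑ j, d j = (n : ℝ) - k := by
      rw [hd, Fin.sum_univ_eq_sum_range (fun j => if k ≤ j then (1 : ℝ) else 0) n]
      rw [← Finset.sum_filter, Finset.sum_const, nsmul_eq_mul, mul_one]
      have : Finset.filter (fun j => k ≤ j) (Finset.range n) = Finset.Ico k n := by
        ext; simp; tauto
      rw [this, Nat.card_Ico, Nat.cast_sub hk.le]
    set t := lam ⟨k, hk⟩ with ht
    have h : ∑ j, (lam j * c j - (if k ≤ (j : ℕ) then lam j else 0) - t * (c j - d j)) ≥ 0 := by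
      apply Finset.sum_nonneg
      intro j _
      by_cases hj : k ≤ (j : ℕ)
      · have : lam j ≤ t := by
          rcases hj.eq_or_lt with h | h
          · have : j = ⟨k, hk⟩ := Fin.ext h.symm
            rw [this]
          · exact hanti _ _ (Fin.lt_def.2 h)
        simp only [hd, if_pos hj]
        nlinarith [h1 j]
      · have : t ≤ lam j := hanti _ _ (Fin.lt_def.2 (not_le.1 hj))
        simp only [hd, if_neg hj]
        nlinarith [h0 j]
    rw [Finset.sum_sub_distrib, Finset.sum_sub_distrib, ← Finset.mul_sum, Finset.sum_sub_distrib,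
      hs, hsd] at h
    linarith

/-- (Lemma 7.3: the affine subspace through the center of mass spanned by
the top `k` directional second-moment directions minimizes the `L²` distance among all
`k`-dimensional affine subspaces, with value the sum of the remaining moments). -/
theorem statement15 (n : ℕ) (μ : Measure (En n)) [IsProbabilityMeasure μ]
    (hsupp : μ ((ball (0 : En n) 1)ᶜ) = 0)
    (xcm : En n) (hxcm : xcm = ∫ z, z ∂μ)
    (v : OrthonormalBasis (Fin n) ℝ (En n))
    (lam : Fin n → ℝ) (hlam_nonneg : ∀ j, 0 ≤ lam j)
    (hlam : ∀ j, lam j = ∫ x, ⟪x - xcm, v j⟫ ^ 2 ∂μ)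
    (hmax : ∀ j : Fin n, ∀ w : En n, ‖w‖ = 1 → (∀ i : Fin n, i < j → ⟪w, v i⟫ = 0) →
      (∫ x, ⟪x - xcm, w⟫ ^ 2 ∂μ) ≤ lam j) :
    ∀ k : ℕ, k ≤ n →
      (∀ L : AffineSubspace ℝ (En n), IsAffineSubspaceDim n k L →
        (∫ x, Metric.infDist x
            {y : En n | ∃ w ∈ Submodule.span ℝ (v '' {i : Fin n | (i : ℕ) < k}),
              y = xcm + w} ^ 2 ∂μ)
          ≤ ∫ x, Metric.infDist x (L : Set (En n)) ^ 2 ∂μ) ∧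
      (∫ x, Metric.infDist x
          {y : En n | ∃ w ∈ Submodule.span ℝ (v '' {i : Fin n | (i : ℕ) < k}),
            y = xcm + w} ^ 2 ∂μ)
        = ∑ j : Fin n, (if k ≤ (j : ℕ) then lam j else 0) := by
  intro k hk
  have hB := aux_B μ hsupp xcm v lam hlam hmax
  have hQ := aux_Q μ hsupp xcm v lam hlam hB
  have hv := orthonormal_iff_ite.1 v.orthonormal
  have hanti : ∀ i j, i < j → lam j ≤ lam i := by
    intro i j hij
    rw [hlam j]
    refine hmax i (v j) (v.orthonormal.1 j) fun l hl => ?_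
    rw [hv, if_neg (hl.trans hij).ne']
  have hval : (∫ x, Metric.infDist x
          {y : En n | ∃ w ∈ Submodule.span ℝ (v '' {i : Fin n | (i : ℕ) < k}),
            y = xcm + w} ^ 2 ∂μ)
        = ∑ j : Fin n, (if k ≤ (j : ℕ) then lam j else 0) := by
    have hS : ∀ y, y ∈ {y : En n | ∃ w ∈ Submodule.span ℝ (v '' {i : Fin n | (i : ℕ) < k}),
            y = xcm + w} ↔ ∀ i : {j : Fin n // k ≤ (j : ℕ)}, ⟪y - xcm, v i⟫ = 0 := by
      intro y
      constructor
      · rintro ⟨w, hw, rfl⟩ ⟨i, hi⟩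
        rw [add_sub_cancel_left]
        induction hw using Submodule.span_induction with
        | mem x hx =>
          obtain ⟨l, hl, rfl⟩ := hx
          have hl' : (l : ℕ) < k := hl
          have : l ≠ i := by rintro rfl; omega
          rw [hv, if_neg this]
        | zero => simp
        | add x y _ _ hx hy => rw [inner_add_left, hx, hy, add_zero]
        | smul a x _ hx => rw [real_inner_smul_left, hx, mul_zero]
      · intro h
        refine ⟨y - xcm, ?_, by abel⟩
        rw [← v.sum_repr (y - xcm)]
        refine Submodule.sum_mem _ fun i _ => ?_
        by_cases hi : k ≤ (i : ℕ)
        · have := h ⟨i, hi⟩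
          rw [v.repr_apply_apply, real_inner_comm, this, zero_smul]
          exact Submodule.zero_mem _
        · exact Submodule.smul_mem _ _ (Submodule.subset_span ⟨i, not_le.1 hi, rfl⟩)
    have hu : Orthonormal ℝ (fun i : {j : Fin n // k ≤ (j : ℕ)} => v i) :=
      v.orthonormal.comp _ Subtype.val_injective
    simp_rw [aux_infDist _ hu _ xcm hS]
    rw [integral_finsetSum _ (fun i _ => by
      simpa [sq] using aux_int μ hsupp xcm xcm (v i) (v i))]
    simp_rw [← hlam]
    rw [← Finset.sum_filter]
    exact (Finset.sum_subtype _ (by simp) lam).symm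
  refine ⟨fun L hL => ?_, hval⟩
  rw [hval]
  obtain ⟨⟨p, hp⟩, hdim⟩ := hL
  set W := L.direction with hW
  let b := stdOrthonormalBasis ℝ Wᗮ
  set u : Fin (Module.finrank ℝ Wᗮ) → En n := fun i => (b i : En n) with hu_def
  have hu : Orthonormal ℝ u := b.orthonormal.comp_linearIsometry Wᗮ.subtypeₗᵢ
  have hS : ∀ y, y ∈ (L : Set (En n)) ↔ ∀ i, ⟪y - p, u i⟫ = 0 := by
    intro y
    have h1 : y ∈ (L : Set (En n)) ↔ y - p ∈ W := by
      rw [SetLike.mem_coe, hW, ← vsub_eq_sub, AffineSubspace.vsub_right_mem_direction_iff_mem hp]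
    rw [h1]
    constructor
    · intro h i
      exact (Submodule.mem_orthogonal _ _).1 (b i).2 _ h
    · intro h
      rw [← Submodule.orthogonal_orthogonal W, Submodule.mem_orthogonal]
      intro z hz
      have hz' := congrArg (Subtype.val) (b.sum_repr ⟨z, hz⟩)
      simp only [Submodule.coe_sum, Submodule.coe_smul] at hz'
      rw [← hz', sum_inner]
      refine Finset.sum_eq_zero fun i _ => ?_
      rw [real_inner_smul_left, real_inner_comm]
      have := h i
      rw [this, mul_zero]
  simp_rw [aux_infDist u hu _ p hS]
  rw [integral_finsetSum _ (fun i _ => by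
      simpa [sq] using aux_int μ hsupp p p (u i) (u i))]
  refine le_trans ?_ (Finset.sum_le_sum fun i _ => aux_var μ hsupp xcm hxcm p (u i))
  simp_rw [hQ]
  rw [Finset.sum_comm]
  simp_rw [← Finset.mul_sum]
  apply aux_comb k hk lam _ hlam_nonneg hanti
  · intro j; positivity
  · intro j
    have := hu.sum_inner_products_le (v j) (s := Finset.univ)
    simpa [v.orthonormal.1 j] using this
  · rw [Finset.sum_comm]
    have h1 : ∀ i, ∑ j, ⟪u i, v j⟫ ^ 2 = 1 := by
      intro i
      have := v.sum_sq_norm_inner_left (u i)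
      simpa [hu.1 i] using this
    simp_rw [h1]
    have h2 := Submodule.finrank_add_finrank_orthogonal W
    rw [hdim, finrank_euclideanSpace_fin] at h2
    simp
    have h3 : ((k + Module.finrank ℝ Wᗮ : ℕ) : ℝ) = (n : ℝ) := congrArg _ h2
    push_cast at h3; linarith
end
end

section
/- Let μ be a Borel probability measure on ℝⁿ supported in B_1(0), with center of mass x_cm := ∫ x dμ(x). Let (v_1, …, v_n) be an orthonormal basis of ℝⁿ and λ_1, …, λ_n ≥ 0 be such that for each j: λ_j = ∫ ⟨x − x_cm, v_j⟩² dμ(x), and for every unit vector v ∈ ℝⁿ orthogonal to v_1, …, v_{j-1} one has ∫ ⟨x − x_cm, v⟩² dμ(x) ≤ λ_j. Then for each j = 1, …, n the Euler–Lagrange identity ∫ ⟨x − x_cm, v_j⟩ (x − x_cm) dμ(x) = λ_j v_j holds (the left-hand side being a Bochner integral in ℝⁿ). -/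
open MeasureTheory Metric Set
open scoped RealInnerProductSpace

noncomputable section

theorem vec_integrable (n : ℕ) (μ : Measure (En n)) [IsProbabilityMeasure μ]
    (hsupp : μ ((ball (0 : En n) 1)ᶜ) = 0) (c a : En n) :
    Integrable (fun x => ⟪x - c, a⟫ • (x - c)) μ := by
  have hcont : Continuous (fun x : En n => ⟪x - c, a⟫ • (x - c)) := by fun_prop
  refine Integrable.of_bound hcont.aestronglyMeasurable ((1 + ‖c‖) * ‖a‖ * (1 + ‖c‖)) ?_
  have h : ∀ᵐ x ∂μ, x ∈ ball (0 : En n) 1 := hsupp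
  filter_upwards [h] with x hx
  have hx1 : ‖x‖ < 1 := by simpa using hx
  have h1 : ‖x - c‖ ≤ 1 + ‖c‖ := (norm_sub_le x c).trans (by linarith)
  rw [norm_smul]
  have h2 : ‖⟪x - c, a⟫‖ ≤ ‖x - c‖ * ‖a‖ := norm_inner_le_norm _ _
  have h3 : ‖⟪x - c, a⟫‖ ≤ (1 + ‖c‖) * ‖a‖ := h2.trans (by gcongr)
  gcongr

theorem scal_integrable (n : ℕ) (μ : Measure (En n)) [IsProbabilityMeasure μ]
    (hsupp : μ ((ball (0 : En n) 1)ᶜ) = 0) (c a b : En n) :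
    Integrable (fun x => ⟪x - c, a⟫ * ⟪x - c, b⟫) μ := by
  have h := (vec_integrable n μ hsupp c a).inner_const (𝕜 := ℝ) b
  simpa [real_inner_smul_left] using h

theorem offdiag (n : ℕ) (μ : Measure (En n)) [IsProbabilityMeasure μ]
    (hsupp : μ ((ball (0 : En n) 1)ᶜ) = 0)
    (xcm : En n)
    (v : OrthonormalBasis (Fin n) ℝ (En n))
    (lam : Fin n → ℝ)
    (hlam : ∀ j, lam j = ∫ x, ⟪x - xcm, v j⟫ ^ 2 ∂μ)
    (hmax : ∀ j : Fin n, ∀ w : En n, ‖w‖ = 1 → (∀ i : Fin n, i < j → ⟪w, v i⟫ = 0) →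
      (∫ x, ⟪x - xcm, w⟫ ^ 2 ∂μ) ≤ lam j) (i k : Fin n) (hik : i < k) :
    ∫ x, ⟪x - xcm, v i⟫ * ⟪x - xcm, v k⟫ ∂μ = 0 := by
  set B := ∫ x, ⟪x - xcm, v i⟫ * ⟪x - xcm, v k⟫ ∂μ with hB
  have key : ∀ t : ℝ, lam i + 2 * t * B + t ^ 2 * lam k ≤ lam i * (1 + t ^ 2) := by
    intro t
    set u := v i + t • v k with hu
    have hvi : ∀ a b, ⟪v a, v b⟫ = if a = b then (1 : ℝ) else 0 :=
      orthonormal_iff_ite.mp v.orthonormal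
    have hn : ‖u‖ ^ 2 = 1 + t ^ 2 := by
      rw [← real_inner_self_eq_norm_sq, hu]
      simp only [inner_add_left, inner_add_right, real_inner_smul_left, real_inner_smul_right, hvi,
        if_neg hik.ne, if_neg hik.ne', if_true]
      ring
    have hpos : 0 < ‖u‖ := by
      have : 0 < ‖u‖ ^ 2 := by rw [hn]; positivity
      exact lt_of_le_of_ne (norm_nonneg u) (fun h0 => by rw [← h0] at this; norm_num at this)
    have h := hmax i (‖u‖⁻¹ • u) (by rw [norm_smul, norm_inv, norm_norm]; field_simp) (by
      intro l hl
      rw [real_inner_smul_left, hu, inner_add_left, real_inner_smul_left, hvi, hvi,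
        if_neg hl.ne', if_neg (hl.trans hik).ne']
      simp)
    have e1 : ∀ x : En n, ⟪x - xcm, ‖u‖⁻¹ • u⟫ ^ 2 = (‖u‖ ^ 2)⁻¹ * ⟪x - xcm, u⟫ ^ 2 := by
      intro x
      rw [real_inner_smul_right, mul_pow, inv_pow]
    simp_rw [e1] at h
    rw [integral_const_mul, hn, inv_mul_le_iff₀ (by positivity)] at h
    have e2 : ∀ x : En n, ⟪x - xcm, u⟫ ^ 2 = (⟪x - xcm, v i⟫ * ⟪x - xcm, v i⟫ +
        2 * t * (⟪x - xcm, v i⟫ * ⟪x - xcm, v k⟫)) + t ^ 2 * (⟪x - xcm, v k⟫ * ⟪x - xcm, v k⟫) := by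
      intro x
      rw [hu, inner_add_right, real_inner_smul_right]
      ring
    have I := fun a b => scal_integrable n μ hsupp xcm (v a) (v b)
    simp_rw [e2] at h
    have I2 : Integrable (fun x => ⟪x - xcm, v i⟫ * ⟪x - xcm, v i⟫ +
        2 * t * (⟪x - xcm, v i⟫ * ⟪x - xcm, v k⟫)) μ := (I i i).add ((I i k).const_mul _)
    rw [integral_add I2 ((I k k).const_mul _),
      integral_add (I i i) ((I i k).const_mul _), integral_const_mul, integral_const_mul] at h
    simp_rw [← pow_two] at h
    rw [← hlam, ← hlam] at h
    linarith
  set d := lam i - lam k with hd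
  have hk := key (B / (|d| + 1))
  have hD : 0 < |d| + 1 := by positivity
  have h2 : 2 * (B / (|d| + 1)) * B ≤ (B / (|d| + 1)) ^ 2 * d := by rw [hd]; rw [hd] at hk; linarith
  set t := B / (|d| + 1) with ht
  have hBt : B = t * (|d| + 1) := by rw [ht]; field_simp
  have ht0 : t = 0 := by
    rw [hBt] at h2
    have := le_abs_self d
    have := abs_nonneg d
    have : t ^ 2 ≤ 0 := by nlinarith [sq_nonneg t, mul_nonneg (sq_nonneg t) (sub_nonneg.2 (le_abs_self d)), mul_nonneg (sq_nonneg t) (abs_nonneg d)]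
    nlinarith [sq_nonneg t, pow_eq_zero_iff (two_ne_zero) |>.mp (le_antisymm this (sq_nonneg t))]
  rw [hBt, ht0, zero_mul]

/-- Lemma 7.4: Euler–Lagrange equations for the directional
second-moment maximizing directions of a probability measure. -/
theorem statement16 (n : ℕ) (μ : Measure (En n)) [IsProbabilityMeasure μ]
    (hsupp : μ ((ball (0 : En n) 1)ᶜ) = 0)
    (xcm : En n) (hxcm : xcm = ∫ z, z ∂μ)
    (v : OrthonormalBasis (Fin n) ℝ (En n))
    (lam : Fin n → ℝ) (hlam_nonneg : ∀ j, 0 ≤ lam j)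
    (hlam : ∀ j, lam j = ∫ x, ⟪x - xcm, v j⟫ ^ 2 ∂μ)
    (hmax : ∀ j : Fin n, ∀ w : En n, ‖w‖ = 1 → (∀ i : Fin n, i < j → ⟪w, v i⟫ = 0) →
      (∫ x, ⟪x - xcm, w⟫ ^ 2 ∂μ) ≤ lam j) :
    ∀ j : Fin n, (∫ x, ⟪x - xcm, v j⟫ • (x - xcm) ∂μ) = lam j • v j := by
  intro j
  refine InnerProductSpace.ext_inner_left_basis v.toBasis ?_
  intro k
  rw [v.coe_toBasis, ← integral_inner (vec_integrable n μ hsupp xcm (v j)), real_inner_smul_right,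
    orthonormal_iff_ite.mp v.orthonormal]
  have e : ∀ x : En n, ⟪v k, ⟪x - xcm, v j⟫ • (x - xcm)⟫ = ⟪x - xcm, v j⟫ * ⟪x - xcm, v k⟫ := by
    intro x
    rw [real_inner_smul_right, real_inner_comm (x - xcm) (v k)]
  simp_rw [e]
  rcases lt_trichotomy j k with h | h | h
  · rw [offdiag n μ hsupp xcm v lam hlam hmax j k h, if_neg h.ne', mul_zero]
  · subst h
    simp_rw [← pow_two]
    rw [← hlam]; simp
  · have h0 := offdiag n μ hsupp xcm v lam hlam hmax k j h
    have e3 : ∀ x : En n, ⟪x - xcm, v j⟫ * ⟪x - xcm, v k⟫ = ⟪x - xcm, v k⟫ * ⟪x - xcm, v j⟫ :=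
      fun x => mul_comm _ _
    rw [integral_congr_ae (Filter.Eventually.of_forall e3), h0, if_neg h.ne, mul_zero]
end
end
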